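/- Under the Algorithm 1 setup with stepsizes α_t = 1/t^c, β_t = 1/t^κ, γ_t = 1/t^{1−κ} for constants c, κ ∈ (0,1), for any T ∈ ℕ₊ the sequence x_T generated by Algorithm 1 satisfies ‖[Σ_{t=1}^T g_t(x_t)]_+‖² ≤ C₂ T^{max{2−c, 2−κ}} + K C_{2,1} T^{max{1, 1+c−κ}} V*_Φ, where [·]_+ is the componentwise positive part, V*_Φ = min_{y_T ∈ X_T} V_Φ(y_T), C_{2,1} = 2n(2G²/((1−c)σ̲) + 1/(1−κ) + 2), C₂ = C_{2,1}(2nF + C₁), C₁ = C_{1,1}/κ + C_{1,2}/(1−c) + 2n·d(X)·K, C_{1,1} = 3n²τB₁F/(1−λ) + nB₁²/2, C_{1,2} = 4nG²/σ̲, τ = (1 − w/(2n²))^{−2}, λ = (1 − w/(2n²))^{1/ι}, and B₁ = 2F + G·d(X). -/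

import Mathlib

open scoped RealInnerProductSpace

noncomputable section

/-- Bregman divergence generated by `ψ` with gradient map `ψ'`. -/
def breg {d : ℕ} (ψ : EuclideanSpace ℝ (Fin d) → ℝ)
    (ψ' : EuclideanSpace ℝ (Fin d) → EuclideanSpace ℝ (Fin d))
    (x y : EuclideanSpace ℝ (Fin d)) : ℝ :=
  ψ x - ψ y - ⟪ψ' y, x - y⟫

/-- Componentwise positive part `[v]₊`. -/
def posPart {d : ℕ} (v : EuclideanSpace ℝ (Fin d)) : EuclideanSpace ℝ (Fin d) :=
  (WithLp.equiv 2 (Fin d → ℝ)).symm fun j => max (v j) 0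

/-- Build a Euclidean vector from a coordinate function. -/
def vecOf {d : ℕ} (v : Fin d → ℝ) : EuclideanSpace ℝ (Fin d) :=
  (WithLp.equiv 2 (Fin d → ℝ)).symm v

/-- Stack a family of per-agent vectors into the Euclidean product space. -/
def stack {n : ℕ} {p : Fin n → ℕ} (y : ∀ i, EuclideanSpace ℝ (Fin (p i))) :
    PiLp 2 (fun i => EuclideanSpace ℝ (Fin (p i))) :=
  (WithLp.equiv 2 (∀ i, EuclideanSpace ℝ (Fin (p i)))).symm y

/-- The setup and iterates of Algorithm 1 (distributed online primal-dual
dynamic mirror descent) of the paper. -/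
structure Alg (n m : ℕ) (p : Fin n → ℕ) where
  hn : 0 < n
  hm : 0 < m
  X : ∀ i : Fin n, Set (EuclideanSpace ℝ (Fin (p i)))
  hXconvex : ∀ i, Convex ℝ (X i)
  hXcompact : ∀ i, IsCompact (X i)
  hXnonempty : ∀ i, (X i).Nonempty
  dX : ℝ
  hdX : 0 < dX
  hdiam : ∀ u v : PiLp 2 (fun i => EuclideanSpace ℝ (Fin (p i))),
    (∀ i, u i ∈ X i) → (∀ i, v i ∈ X i) → ‖u - v‖ ≤ dX
  f : ℕ → ∀ i : Fin n, EuclideanSpace ℝ (Fin (p i)) → ℝ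
  r : ℕ → ∀ i : Fin n, EuclideanSpace ℝ (Fin (p i)) → ℝ
  g : ℕ → ∀ i : Fin n, EuclideanSpace ℝ (Fin (p i)) → EuclideanSpace ℝ (Fin m)
  hf0 : ∀ i z, f 0 i z = 0
  hr0 : ∀ i z, r 0 i z = 0
  hg0 : ∀ i z, g 0 i z = 0
  hfconvex : ∀ t i, ConvexOn ℝ (X i) (f t i)
  hrconvex : ∀ t i, ConvexOn ℝ (X i) (r t i)
  hgconvex : ∀ t i (j : Fin m), ConvexOn ℝ (X i) (fun z => g t i z j)
  F : ℝ
  hF : 0 < F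
  G : ℝ
  hG : 0 < G
  hfbound : ∀ t i, ∀ z ∈ X i, |f t i z| ≤ F
  hrbound : ∀ t i, ∀ z ∈ X i, |r t i z| ≤ F
  hgbound : ∀ t i, ∀ z ∈ X i, ‖g t i z‖ ≤ F
  Gf : ℕ → ∀ i : Fin n, EuclideanSpace ℝ (Fin (p i)) → EuclideanSpace ℝ (Fin (p i))
  Gr : ℕ → ∀ i : Fin n, EuclideanSpace ℝ (Fin (p i)) → EuclideanSpace ℝ (Fin (p i))
  Gg : ℕ → ∀ i : Fin n, EuclideanSpace ℝ (Fin (p i)) → Fin m → EuclideanSpace ℝ (Fin (p i))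
  hGfsub : ∀ t i, ∀ z ∈ X i, ∀ u ∈ X i, f t i z + ⟪Gf t i z, u - z⟫ ≤ f t i u
  hGrsub : ∀ t i, ∀ z ∈ X i, ∀ u ∈ X i, r t i z + ⟪Gr t i z, u - z⟫ ≤ r t i u
  hGgsub : ∀ t i, ∀ z ∈ X i, ∀ (j : Fin m), ∀ u ∈ X i,
    g t i z j + ⟪Gg t i z j, u - z⟫ ≤ g t i u j
  hGfbound : ∀ t i, ∀ z ∈ X i, ‖Gf t i z‖ ≤ G
  hGrbound : ∀ t i, ∀ z ∈ X i, ‖Gr t i z‖ ≤ G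
  hGgbound : ∀ t i, ∀ z ∈ X i, ∀ v, ‖vecOf (fun j => ⟪Gg t i z j, v⟫)‖ ≤ G * ‖v‖
  W : ℕ → Matrix (Fin n) (Fin n) ℝ
  hWnonneg : ∀ t i j, 0 ≤ W t i j
  hWrow : ∀ t i, ∑ j, W t i j = 1
  hWcol : ∀ t j, ∑ i, W t i j = 1
  w : ℝ
  hw0 : 0 < w
  hw1 : w < 1
  hWdiag : ∀ t i, w ≤ W t i i
  hWpos : ∀ t i j, 0 < W t i j → w ≤ W t i j
  iota : ℕ
  hiota : 0 < iota
  hconn : ∀ (t : ℕ) (c d : Fin n),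
    Relation.ReflTransGen (fun u v : Fin n => ∃ l < iota, 0 < W (t + l) v u) c d
  ψ : ∀ i : Fin n, EuclideanSpace ℝ (Fin (p i)) → ℝ
  ψ' : ∀ i : Fin n, EuclideanSpace ℝ (Fin (p i)) → EuclideanSpace ℝ (Fin (p i))
  hψgrad : ∀ i z, HasGradientAt (ψ i) (ψ' i z) z
  σ : Fin n → ℝ
  hσ : ∀ i, 0 < σ i
  hψstrong : ∀ i, ∀ z ∈ X i, ∀ u ∈ X i,
    ψ i u + ⟪ψ' i u, z - u⟫ + σ i / 2 * ‖z - u‖ ^ 2 ≤ ψ i z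
  K : ℝ
  hK : 0 < K
  hbregLip : ∀ i, ∀ z₁ ∈ X i, ∀ z₂ ∈ X i, ∀ u ∈ X i,
    |breg (ψ i) (ψ' i) z₁ u - breg (ψ i) (ψ' i) z₂ u| ≤ K * ‖z₁ - z₂‖
  Φ : ℕ → ∀ i : Fin n, EuclideanSpace ℝ (Fin (p i)) → EuclideanSpace ℝ (Fin (p i))
  hΦmaps : ∀ t i, ∀ z ∈ X i, Φ t i z ∈ X i
  hΦcontract : ∀ t i, ∀ z ∈ X i, ∀ u ∈ X i,
    breg (ψ i) (ψ' i) (Φ t i z) (Φ t i u) ≤ breg (ψ i) (ψ' i) z u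
  α : ℕ → ℝ
  β : ℕ → ℝ
  γ : ℕ → ℝ
  hαpos : ∀ t, 1 ≤ t → 0 < α t
  hβpos : ∀ t, 1 ≤ t → 0 < β t
  hγpos : ∀ t, 1 ≤ t → 0 < γ t
  hαanti : ∀ s t, 1 ≤ s → s ≤ t → α t ≤ α s
  hβanti : ∀ s t, 1 ≤ s → s ≤ t → β t ≤ β s
  hγanti : ∀ s t, 1 ≤ s → s ≤ t → γ t ≤ γ s
  x : ℕ → ∀ i : Fin n, EuclideanSpace ℝ (Fin (p i))
  xtil : ℕ → ∀ i : Fin n, EuclideanSpace ℝ (Fin (p i))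
  q : ℕ → Fin n → EuclideanSpace ℝ (Fin m)
  qtil : ℕ → Fin n → EuclideanSpace ℝ (Fin m)
  a : ℕ → ∀ i : Fin n, EuclideanSpace ℝ (Fin (p i))
  b : ℕ → Fin n → EuclideanSpace ℝ (Fin m)
  hx0 : ∀ i, x 0 i ∈ X i
  hq0 : ∀ i, q 0 i = 0
  hqtil : ∀ t, 1 ≤ t → ∀ i, qtil t i = ∑ j, W (t - 1) i j • q (t - 1) j
  ha : ∀ t, 1 ≤ t → ∀ i,
    a t i = Gf (t - 1) i (x (t - 1) i) + ∑ j, qtil t i j • Gg (t - 1) i (x (t - 1) i) j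
  hxtilmem : ∀ t, 1 ≤ t → ∀ i, xtil t i ∈ X i
  hxtilmin : ∀ t, 1 ≤ t → ∀ i, ∀ z ∈ X i,
    α t * ⟪xtil t i, a t i⟫ + α t * r (t - 1) i (xtil t i)
        + breg (ψ i) (ψ' i) (xtil t i) (x (t - 1) i)
      ≤ α t * ⟪z, a t i⟫ + α t * r (t - 1) i z + breg (ψ i) (ψ' i) z (x (t - 1) i)
  hb : ∀ t, 1 ≤ t → ∀ i,
    b t i = vecOf (fun j => ⟪Gg (t - 1) i (x (t - 1) i) j, xtil t i - x (t - 1) i⟫)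
      + g (t - 1) i (x (t - 1) i)
  hq : ∀ t, 1 ≤ t → ∀ i,
    q t i = posPart (qtil t i + γ t • (b t i - β t • qtil t i))
  hx : ∀ t, 1 ≤ t → ∀ i, x t i = Φ t i (xtil t i)

namespace Alg

variable {n m : ℕ} {p : Fin n → ℕ}

/-- Average dual variable `q̄_t`. -/
def qbar (S : Alg n m p) (t : ℕ) : EuclideanSpace ℝ (Fin m) :=
  (n : ℝ)⁻¹ • ∑ i, S.q t i

/-- `σ̲ = min_i σ_i`. -/
def sigmin (S : Alg n m p) : ℝ :=
  Finset.univ.inf' (Finset.univ_nonempty_iff.mpr ⟨⟨0, S.hn⟩⟩) S.σ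

/-- `τ = (1 − w/(2n²))⁻²`. -/
def tau (S : Alg n m p) : ℝ := ((1 - S.w / (2 * (n : ℝ) ^ 2)) ^ 2)⁻¹

/-- `λ = (1 − w/(2n²))^{1/ι}`. -/
def lam (S : Alg n m p) : ℝ := (1 - S.w / (2 * (n : ℝ) ^ 2)) ^ ((S.iota : ℝ))⁻¹

/-- `B₁ = 2F + G d(X)`. -/
def B1 (S : Alg n m p) : ℝ := 2 * S.F + S.G * S.dX

/-- `E₁(t) = n²τB₁F Σ_{s=1}^{t−1} γ_{s+1} λ^{t−1−s}`. -/
def E1 (S : Alg n m p) (t : ℕ) : ℝ :=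
  (n : ℝ) ^ 2 * S.tau * S.B1 * S.F *
    ∑ s ∈ Finset.Icc 1 (t - 1), S.γ (s + 1) * S.lam ^ (t - 1 - s)

/-- Global objective `f_t(y) = Σ_i (f_{i,t}(y_i) + r_{i,t}(y_i))`. -/
def fsum (S : Alg n m p) (t : ℕ) (y : ∀ i, EuclideanSpace ℝ (Fin (p i))) : ℝ :=
  ∑ i, (S.f t i (y i) + S.r t i (y i))

/-- Global constraint `g_t(y) = Σ_i g_{i,t}(y_i)`. -/
def gsum (S : Alg n m p) (t : ℕ) (y : ∀ i, EuclideanSpace ℝ (Fin (p i))) :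
    EuclideanSpace ℝ (Fin m) :=
  ∑ i, S.g t i (y i)

/-- Regret against a comparator sequence. -/
def reg (S : Alg n m p) (T : ℕ) (y : ℕ → ∀ i, EuclideanSpace ℝ (Fin (p i))) : ℝ :=
  ∑ t ∈ Finset.Icc 1 T, S.fsum t (S.x t) - ∑ t ∈ Finset.Icc 1 T, S.fsum t (y t)

/-- Feasibility of a comparator sequence on `1..T`. -/
def Feasible (S : Alg n m p) (T : ℕ) (y : ℕ → ∀ i, EuclideanSpace ℝ (Fin (p i))) : Prop :=
  ∀ t ∈ Finset.Icc 1 T, (∀ i, y t i ∈ S.X i) ∧ ∀ j, S.gsum t (y t) j ≤ 0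

/-- Accumulated dynamic variation `V_Φ(y_T)`. -/
def VPhi (S : Alg n m p) (T : ℕ) (y : ℕ → ∀ i, EuclideanSpace ℝ (Fin (p i))) : ℝ :=
  ∑ t ∈ Finset.Icc 1 (T - 1), ∑ i, ‖y (t + 1) i - S.Φ (t + 1) i (y t i)‖

/-- `E₂(t)` for a comparator sequence. -/
def E2 (S : Alg n m p) (y : ℕ → ∀ i, EuclideanSpace ℝ (Fin (p i))) (t : ℕ) : ℝ :=
  (S.α t)⁻¹ * ∑ i, (breg (S.ψ i) (S.ψ' i) (y (t - 1) i) (S.x (t - 1) i)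
    - breg (S.ψ i) (S.ψ' i) (y t i) (S.x t i))

/-- `C_{1,1} = 3n²τB₁F/(1−λ) + nB₁²/2`. -/
def C11 (S : Alg n m p) : ℝ :=
  3 * (n : ℝ) ^ 2 * S.tau * S.B1 * S.F / (1 - S.lam) + (n : ℝ) * S.B1 ^ 2 / 2

/-- `C_{1,2} = 4nG²/σ̲`. -/
def C12 (S : Alg n m p) : ℝ := 4 * (n : ℝ) * S.G ^ 2 / S.sigmin

/-- Constraint violation `‖[Σ_{t=1}^T g_t(x_t)]₊‖`. -/
def violation (S : Alg n m p) (T : ℕ) : ℝ :=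
  ‖posPart (∑ t ∈ Finset.Icc 1 T, S.gsum t (S.x t))‖

end Alg


section Consensus

open Finset

variable {n : ℕ}

/-- Averaging with a doubly stochastic matrix decreases the sum of squares by the total
spread of the rows around their averages. -/
lemma sum_sq_sub_sum_sq_mix (W : Matrix (Fin n) (Fin n) ℝ)
    (hrow : ∀ i, ∑ j, W i j = 1) (hcol : ∀ j, ∑ i, W i j = 1) (x y : Fin n → ℝ)
    (hy : ∀ i, y i = ∑ j, W i j * x j) :
    ∑ i, ∑ j, W i j * (x j - y i) ^ 2 = ∑ j, x j ^ 2 - ∑ i, y i ^ 2 := by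
  have h1 : ∀ i, ∑ j, W i j * (x j - y i) ^ 2 = ∑ j, W i j * x j ^ 2 - y i ^ 2 := by
    intro i
    have : ∀ j, W i j * (x j - y i) ^ 2
        = W i j * x j ^ 2 - 2 * y i * (W i j * x j) + y i ^ 2 * W i j := fun j => by ring
    simp_rw [this, sum_add_distrib, sum_sub_distrib, ← mul_sum, hrow, ← hy]
    ring
  simp_rw [h1, sum_sub_distrib]
  rw [sum_comm]
  simp_rw [← sum_mul, hcol, one_mul]

/-- Averaging that does not communicate across a cut preserves one-sided bounds on both sides. -/
lemma mix_bounds_of_no_cross (W : Matrix (Fin n) (Fin n) ℝ) (hnn : ∀ i j, 0 ≤ W i j)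
    (hrow : ∀ i, ∑ j, W i j = 1) (x y : Fin n → ℝ)
    (hy : ∀ i, y i = ∑ j, W i j * x j) (P : Fin n → Prop) (a b : ℝ)
    (hno : ∀ i j, ¬ (P i ↔ P j) → W i j = 0)
    (ha : ∀ i, P i → x i ≤ a) (hb : ∀ i, ¬ P i → b ≤ x i) :
    (∀ i, P i → y i ≤ a) ∧ ∀ i, ¬ P i → b ≤ y i := by
  constructor
  · intro i hi
    calc y i = ∑ j, W i j * x j := hy i
      _ ≤ ∑ j, W i j * a := by
        refine sum_le_sum fun j _ => ?_
        by_cases hj : P j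
        · exact mul_le_mul_of_nonneg_left (ha j hj) (hnn i j)
        · simp [hno i j (by tauto)]
      _ = a := by rw [← sum_mul, hrow, one_mul]
  · intro i hi
    calc b = ∑ j, W i j * b := by rw [← sum_mul, hrow, one_mul]
      _ ≤ ∑ j, W i j * x j := by
        refine sum_le_sum fun j _ => ?_
        by_cases hj : P j
        · simp [hno i j (by tauto)]
        · exact mul_le_mul_of_nonneg_left (hb j hj) (hnn i j)
      _ = y i := (hy i).symm

lemma sum_sq_le_sq_sum_of_nonneg {ι : Type*} (s : Finset ι) (f : ι → ℝ)
    (hf : ∀ i ∈ s, 0 ≤ f i) : ∑ i ∈ s, f i ^ 2 ≤ (∑ i ∈ s, f i) ^ 2 := by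
  rw [sq (∑ i ∈ s, f i), sum_mul]
  refine sum_le_sum fun i hi => ?_
  rw [sq]
  exact mul_le_mul_of_nonneg_left (single_le_sum hf hi) (hf i hi)

/-- Over a window whose union graph crosses every cut, the sum of squares decreases by at least
`w / 2` times the sum of the squared gaps of the sorted initial values. -/
lemma window_decrease (hn : 0 < n) (W : ℕ → Matrix (Fin n) (Fin n) ℝ) (hnn : ∀ t i j, 0 ≤ W t i j)
    (hrow : ∀ t i, ∑ j, W t i j = 1) (hcol : ∀ t j, ∑ i, W t i j = 1)
    (w : ℝ) (hw : 0 < w) (hdiag : ∀ t i, w ≤ W t i i) (hpos : ∀ t i j, 0 < W t i j → w ≤ W t i j)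
    (N : ℕ)
    (hcut : ∀ P : Fin n → Prop, (∃ i, P i) → (∃ i, ¬ P i) →
      ∃ l < N, ∃ u v, P u ∧ ¬ P v ∧ 0 < W l v u)
    (z : ℕ → Fin n → ℝ) (hz : ∀ l i, z (l + 1) i = ∑ j, W l i j * z l j)
    (rk : Fin n → ℕ) (hrk : ∀ k < n, ∃ i, rk i = k)
    (s : ℕ → ℝ) (hs : Monotone s) (hzs : ∀ i, z 0 i = s (rk i)) :
    ∑ i, z N i ^ 2 + w / 2 * ∑ k ∈ range (n - 1), (s (k + 1) - s k) ^ 2 ≤ ∑ i, z 0 i ^ 2 := by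
  classical
  have : Nonempty (Fin n) := ⟨⟨0, hn⟩⟩
  have hcross : ∀ k ∈ range (n - 1), ∃ l < N, ∃ v, (∃ u, rk u ≤ k ∧ 0 < W l v u) ∧
      (∃ u, k < rk u ∧ 0 < W l v u) ∧ (∀ i, rk i ≤ k → z l i ≤ s k) ∧
      (∀ i, ¬ rk i ≤ k → s (k + 1) ≤ z l i) := by
    intro k hk
    rw [mem_range] at hk
    have hex : ∃ l, l < N ∧ ∃ v u, ¬ (rk v ≤ k ↔ rk u ≤ k) ∧ 0 < W l v u := by
      obtain ⟨i, hi⟩ := hrk k (by omega)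
      obtain ⟨j, hj⟩ := hrk (k + 1) (by omega)
      obtain ⟨l, hl, u, v, hu, hv, hW⟩ := hcut (fun i => rk i ≤ k) ⟨i, hi.le⟩ ⟨j, by omega⟩
      exact ⟨l, hl, v, u, by tauto, hW⟩
    obtain ⟨hl, v, u, hvu, hW⟩ := Nat.find_spec hex
    have hmin := fun l => Nat.find_min (m := l) hex
    have hinv : ∀ l, l ≤ Nat.find hex →
        (∀ i, rk i ≤ k → z l i ≤ s k) ∧ (∀ i, ¬ rk i ≤ k → s (k + 1) ≤ z l i) := by
      intro l
      induction l with
      | zero =>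
        intro _
        exact ⟨fun i hi => (hzs i).trans_le (hs hi),
          fun i hi => (hs (by omega)).trans_eq (hzs i).symm⟩
      | succ l ih =>
        intro hl'
        obtain ⟨h1, h2⟩ := ih (by omega)
        refine mix_bounds_of_no_cross (W l) (hnn l) (hrow l) _ _ (hz l) _ _ _ ?_ h1 h2
        intro i j hij
        by_contra h0
        exact hmin l (by omega) ⟨by omega, i, j, hij, lt_of_le_of_ne (hnn l i j) (Ne.symm h0)⟩
    have hvv : 0 < W (Nat.find hex) v v := hw.trans_le (hdiag _ _)
    refine ⟨_, hl, v, ?_, ?_, hinv _ le_rfl⟩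
    · by_cases h : rk v ≤ k
      · exact ⟨v, h, hvv⟩
      · exact ⟨u, by tauto, hW⟩
    · by_cases h : rk v ≤ k
      · exact ⟨u, by by_contra h'; exact hvu ⟨fun _ => by omega, fun _ => h⟩, hW⟩
      · exact ⟨v, by omega, hvv⟩
  choose! tk htk vk hlo hhi hle hge using hcross
  choose! lo hlo1 hlo2 using hlo
  choose! hi hhi1 hhi2 using hhi
  have hrowdec : ∀ l v, w / 2 * ∑ k ∈ (range (n - 1)).filter (fun k => (tk k, vk k) = (l, v)),
      (s (k + 1) - s k) ^ 2 ≤ ∑ j, W l v j * (z l j - z (l + 1) v) ^ 2 := by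
    intro l v
    set D := (range (n - 1)).filter (fun k => (tk k, vk k) = (l, v)) with hD
    have hrhs : ∀ j, 0 ≤ W l v j * (z l j - z (l + 1) v) ^ 2 :=
      fun j => mul_nonneg (hnn _ _ _) (sq_nonneg _)
    rcases D.eq_empty_or_nonempty with h | hne
    · rw [h]; simpa using sum_nonneg fun j _ => hrhs j
    have hmemD : ∀ k ∈ D, k ∈ range (n - 1) ∧ tk k = l ∧ vk k = v := by
      intro k hk
      simpa [hD] using hk
    obtain ⟨ha1, ha2, ha3⟩ := hmemD _ (D.min'_mem hne)
    obtain ⟨hb1, hb2, hb3⟩ := hmemD _ (D.max'_mem hne)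
    set A := D.min' hne
    set B := D.max' hne
    have hAB : A ≤ B := D.min'_le _ (D.max'_mem hne)
    have hx1 : z l (lo A) ≤ s A := by
      have := hle A ha1 _ (hlo1 A ha1); rwa [ha2] at this
    have hx2 : s (B + 1) ≤ z l (hi B) := by
      have := hge B hb1 (hi B) (by have := hhi1 B hb1; omega); rwa [hb2] at this
    have hw1 : w ≤ W l v (lo A) := by
      have := hpos _ _ _ (hlo2 A ha1); rwa [ha2, ha3] at this
    have hw2 : w ≤ W l v (hi B) := by
      have := hpos _ _ _ (hhi2 B hb1); rwa [hb2, hb3] at this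
    have hneq : lo A ≠ hi B := by
      intro h
      have h1 := hlo1 A ha1
      have h2 := hhi1 B hb1
      rw [h] at h1; omega
    have hgap : ∑ k ∈ D, (s (k + 1) - s k) ≤ s (B + 1) - s A := by
      calc ∑ k ∈ D, (s (k + 1) - s k) ≤ ∑ k ∈ Ico A (B + 1), (s (k + 1) - s k) := by
            refine sum_le_sum_of_subset_of_nonneg ?_ fun k _ _ => sub_nonneg.2 (hs k.le_succ)
            intro k hk
            rw [mem_Ico]
            exact ⟨D.min'_le _ hk, Nat.lt_succ_of_le (D.le_max' _ hk)⟩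
        _ = s (B + 1) - s A := sum_Ico_sub _ (by omega)
    have hsq : ∑ k ∈ D, (s (k + 1) - s k) ^ 2 ≤ (z l (hi B) - z l (lo A)) ^ 2 := by
      refine (sum_sq_le_sq_sum_of_nonneg _ _ fun k _ => sub_nonneg.2 (hs k.le_succ)).trans ?_
      exact pow_le_pow_left₀ (sum_nonneg fun k _ => sub_nonneg.2 (hs k.le_succ)) (by linarith) 2
    have hpair : W l v (lo A) * (z l (lo A) - z (l + 1) v) ^ 2
        + W l v (hi B) * (z l (hi B) - z (l + 1) v) ^ 2
        ≤ ∑ j, W l v j * (z l j - z (l + 1) v) ^ 2 := by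
      rw [← sum_pair (f := fun j => W l v j * (z l j - z (l + 1) v) ^ 2) hneq]
      exact sum_le_sum_of_subset_of_nonneg (subset_univ _) fun j _ _ => hrhs j
    have h1 := mul_le_mul_of_nonneg_right hw1 (sq_nonneg (z l (lo A) - z (l + 1) v))
    have h2 := mul_le_mul_of_nonneg_right hw2 (sq_nonneg (z l (hi B) - z (l + 1) v))
    have h3 := mul_le_mul_of_nonneg_left hsq (half_pos hw).le
    nlinarith [mul_nonneg hw.le (sq_nonneg (z l (lo A) - z (l + 1) v + (z l (hi B) - z (l + 1) v)))]
  have htel : ∑ l ∈ range N, ∑ v, ∑ j, W l v j * (z l j - z (l + 1) v) ^ 2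
      = ∑ i, z 0 i ^ 2 - ∑ i, z N i ^ 2 := by
    rw [← sum_range_sub' (fun l => ∑ i, z l i ^ 2)]
    exact sum_congr rfl fun l _ =>
      sum_sq_sub_sum_sq_mix (W l) (hrow l) (hcol l) _ _ (hz l)
  have hfib : ∑ k ∈ range (n - 1), (s (k + 1) - s k) ^ 2
      = ∑ p ∈ range N ×ˢ (univ : Finset (Fin n)),
        ∑ k ∈ (range (n - 1)).filter (fun k => (tk k, vk k) = p), (s (k + 1) - s k) ^ 2 := by
    refine (sum_fiberwise_of_maps_to (fun k hk => ?_) _).symm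
    simpa using htk k hk
  have : w / 2 * ∑ k ∈ range (n - 1), (s (k + 1) - s k) ^ 2
      ≤ ∑ i, z 0 i ^ 2 - ∑ i, z N i ^ 2 := by
    rw [hfib, sum_product, mul_sum, ← htel]
    refine sum_le_sum fun l _ => ?_
    rw [mul_sum]
    exact sum_le_sum fun v _ => hrowdec l v
  linarith

/-- Contraction of the sum of squares of a centered vector over a connected window. -/
lemma window_contraction (hn : 0 < n) (W : ℕ → Matrix (Fin n) (Fin n) ℝ)
    (hnn : ∀ t i j, 0 ≤ W t i j)
    (hrow : ∀ t i, ∑ j, W t i j = 1) (hcol : ∀ t j, ∑ i, W t i j = 1)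
    (w : ℝ) (hw : 0 < w) (hdiag : ∀ t i, w ≤ W t i i) (hpos : ∀ t i j, 0 < W t i j → w ≤ W t i j)
    (N : ℕ)
    (hcut : ∀ P : Fin n → Prop, (∃ i, P i) → (∃ i, ¬ P i) →
      ∃ l < N, ∃ u v, P u ∧ ¬ P v ∧ 0 < W l v u)
    (z : ℕ → Fin n → ℝ) (hz : ∀ l i, z (l + 1) i = ∑ j, W l i j * z l j)
    (h0 : ∑ i, z 0 i = 0) :
    ∑ i, z N i ^ 2 ≤ (1 - w / (2 * (n : ℝ) ^ 2)) ^ 2 * ∑ i, z 0 i ^ 2 := by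
  set e := Tuple.sort (z 0)
  have hmono : Monotone (z 0 ∘ e) := Tuple.monotone_sort (z 0)
  set s : ℕ → ℝ := fun k => z 0 (e ⟨min k (n - 1), by omega⟩) with hsdef
  have hs : Monotone s := by
    intro a b hab
    exact hmono (Fin.mk_le_mk.2 (min_le_min_right _ hab))
  have hzs : ∀ i, z 0 i = s (e.symm i) := by
    intro i
    have h1 : min (e.symm i : ℕ) (n - 1) = e.symm i := by
      have := (e.symm i).2; omega
    simp only [hsdef, h1, Fin.eta, Equiv.apply_symm_apply]
  have hdec := window_decrease hn W hnn hrow hcol w hw hdiag hpos N hcut z hz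
    (fun i => (e.symm i : ℕ)) (fun k hk => ⟨e ⟨k, hk⟩, by simp⟩) s hs hzs
  set R := s (n - 1) - s 0 with hR
  have hnR : (1 : ℝ) ≤ n := by exact_mod_cast hn
  have hgap : R ^ 2 ≤ n * ∑ k ∈ range (n - 1), (s (k + 1) - s k) ^ 2 := by
    rw [hR, ← sum_range_sub s (n - 1)]
    refine sq_sum_le_card_mul_sum_sq.trans ?_
    refine mul_le_mul_of_nonneg_right ?_ (sum_nonneg fun _ _ => sq_nonneg _)
    simp
  have hV : 4 * ∑ i, z 0 i ^ 2 ≤ n * R ^ 2 := by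
    set μ := (s (n - 1) + s 0) / 2 with hμ
    have h1 : ∀ i, z 0 i ^ 2 - 2 * μ * z 0 i + μ ^ 2 ≤ R ^ 2 / 4 := by
      intro i
      have ha : s 0 ≤ z 0 i := by rw [hzs]; exact hs (Nat.zero_le _)
      have hb : z 0 i ≤ s (n - 1) := by
        rw [hzs]; exact hs (by have := (e.symm i).2; omega)
      rw [hμ, hR]
      nlinarith
    have h2 := sum_le_sum (s := univ) fun i _ => h1 i
    simp only [sum_add_distrib, sum_sub_distrib, ← mul_sum, h0, sum_const, card_univ,
      Fintype.card_fin, nsmul_eq_mul] at h2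
    nlinarith [sq_nonneg μ]
  have hVV : 4 * ∑ i, z 0 i ^ 2 ≤ n ^ 2 * ∑ k ∈ range (n - 1), (s (k + 1) - s k) ^ 2 := by
    nlinarith
  have hn2 : (0 : ℝ) < (n : ℝ) ^ 2 := by positivity
  have hS : 0 ≤ ∑ i, z 0 i ^ 2 := sum_nonneg fun _ _ => sq_nonneg _
  have h3 : w / (n : ℝ) ^ 2 * ∑ i, z 0 i ^ 2
      ≤ w / 2 * ∑ k ∈ range (n - 1), (s (k + 1) - s k) ^ 2 := by
    rw [div_mul_eq_mul_div, div_le_iff₀ hn2]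
    nlinarith
  have h4 : (1 - w / (2 * (n : ℝ) ^ 2)) ^ 2
      = 1 - w / (n : ℝ) ^ 2 + (w / (2 * (n : ℝ) ^ 2)) ^ 2 := by
    field_simp; ring
  rw [h4]
  nlinarith [mul_nonneg (sq_nonneg (w / (2 * (n : ℝ) ^ 2))) hS]

/-- The vectors obtained from `v` by averaging successively with `W s, W (s + 1), …`. -/
def mixIter {E : Type*} [AddCommGroup E] [Module ℝ E] (W : ℕ → Matrix (Fin n) (Fin n) ℝ)
    (s : ℕ) (v : Fin n → E) : ℕ → Fin n → E
  | 0 => v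
  | k + 1 => fun i => ∑ j, W (s + k) i j • mixIter W s v k j

section Decay

variable {m : ℕ} (hn : 0 < n) (W : ℕ → Matrix (Fin n) (Fin n) ℝ) (hnn : ∀ t i j, 0 ≤ W t i j)
    (hrow : ∀ t i, ∑ j, W t i j = 1) (hcol : ∀ t j, ∑ i, W t i j = 1)
    (w : ℝ) (hw : 0 < w) (hw1 : w < 1) (hdiag : ∀ t i, w ≤ W t i i)
    (hpos : ∀ t i j, 0 < W t i j → w ≤ W t i j) (N : ℕ) (hN : 0 < N)
    (hcut : ∀ t, ∀ P : Fin n → Prop, (∃ i, P i) → (∃ i, ¬ P i) →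
      ∃ l < N, ∃ u v, P u ∧ ¬ P v ∧ 0 < W (t + l) v u)

lemma sum_mix {E : Type*} [AddCommGroup E] [Module ℝ E] (A : Matrix (Fin n) (Fin n) ℝ)
    (hcol : ∀ j, ∑ i, A i j = 1) (v : Fin n → E) :
    ∑ i, ∑ j, A i j • v j = ∑ j, v j := by
  rw [sum_comm]
  simp_rw [← sum_smul, hcol, one_smul]

lemma sum_norm_sq_eq (v : Fin n → EuclideanSpace ℝ (Fin m)) :
    ∑ i, ‖v i‖ ^ 2 = ∑ a, ∑ i, v i a ^ 2 := by
  simp_rw [EuclideanSpace.real_norm_sq_eq]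
  exact sum_comm

include hcol in
lemma sum_mixIter (s k : ℕ) (v : Fin n → EuclideanSpace ℝ (Fin m)) :
    ∑ i, mixIter W s v k i = ∑ i, v i := by
  induction k with
  | zero => rfl
  | succ k ih => rw [← ih]; exact sum_mix (W (s + k)) (hcol _) _

include hnn hrow hcol in
lemma sum_norm_sq_mix_le (t : ℕ) (v : Fin n → EuclideanSpace ℝ (Fin m)) :
    ∑ i, ‖∑ j, W t i j • v j‖ ^ 2 ≤ ∑ i, ‖v i‖ ^ 2 := by
  rw [sum_norm_sq_eq, sum_norm_sq_eq]
  refine sum_le_sum fun a _ => ?_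
  have h := sum_sq_sub_sum_sq_mix (W t) (hrow t) (hcol t) (fun j => v j a)
    (fun i => (∑ j, W t i j • v j) a) (fun i => by simp)
  have h' : 0 ≤ ∑ i, ∑ j, W t i j * (v j a - (∑ j, W t i j • v j) a) ^ 2 :=
    sum_nonneg fun i _ => sum_nonneg fun j _ => mul_nonneg (hnn _ _ _) (sq_nonneg _)
  linarith

include hn hnn hrow hcol hw hdiag hpos hcut in
lemma sum_norm_sq_window_le (Z : ℕ → Fin n → EuclideanSpace ℝ (Fin m)) (t : ℕ)
    (hZ : ∀ l i, Z (l + 1) i = ∑ j, W (t + l) i j • Z l j) (h0 : ∑ i, Z 0 i = 0) :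
    ∑ i, ‖Z N i‖ ^ 2 ≤ (1 - w / (2 * (n : ℝ) ^ 2)) ^ 2 * ∑ i, ‖Z 0 i‖ ^ 2 := by
  rw [sum_norm_sq_eq, sum_norm_sq_eq, mul_sum]
  refine sum_le_sum fun a _ => ?_
  refine window_contraction hn (fun l => W (t + l)) (fun l => hnn _) (fun l => hrow _)
    (fun l => hcol _) w hw (fun l => hdiag _) (fun l => hpos _) N (hcut t)
    (fun l i => Z l i a) (fun l i => by simp [hZ]) ?_
  have := congrArg (fun v => v a) h0
  simpa using this

include hn hnn hrow hcol hw hdiag hpos hN hcut in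
lemma sum_norm_sq_mixIter_le (s : ℕ) (v : Fin n → EuclideanSpace ℝ (Fin m))
    (h0 : ∑ i, v i = 0) (k : ℕ) :
    ∑ i, ‖mixIter W s v k i‖ ^ 2
      ≤ ((1 - w / (2 * (n : ℝ) ^ 2)) ^ (k / N)) ^ 2 * ∑ i, ‖v i‖ ^ 2 := by
  have hmono : Antitone fun k => ∑ i, ‖mixIter W s v k i‖ ^ 2 :=
    antitone_nat_of_succ_le fun k => sum_norm_sq_mix_le W hnn hrow hcol (s + k) _
  induction k using Nat.strong_induction_on with
  | _ k ih =>
    rcases lt_or_ge k N with hk | hk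
    · rw [Nat.div_eq_of_lt hk]
      simpa [mixIter] using hmono (Nat.zero_le k)
    · have h1 := ih (k - N) (by omega)
      have h2 := sum_norm_sq_window_le hn W hnn hrow hcol w hw hdiag hpos N hcut
        (fun l => mixIter W s v (k - N + l)) (s + (k - N))
        (fun l i => by rw [← add_assoc, add_assoc s]; rfl)
        (by simpa [h0] using sum_mixIter W hcol s (k - N) v)
      simp only [Nat.sub_add_cancel hk, add_zero] at h2
      have h3 : k / N = (k - N) / N + 1 := by
        rw [← Nat.add_div_right _ hN, Nat.sub_add_cancel hk]
      rw [h3, pow_succ]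
      refine h2.trans ?_
      refine (mul_le_mul_of_nonneg_left h1 (sq_nonneg _)).trans_eq ?_
      ring

lemma sum_norm_sq_sub_avg_le (v : Fin n → EuclideanSpace ℝ (Fin m)) :
    ∑ i, ‖v i - (n : ℝ)⁻¹ • ∑ j, v j‖ ^ 2 ≤ ∑ i, ‖v i‖ ^ 2 := by
  rcases n.eq_zero_or_pos with rfl | hn
  · simp
  set a := (n : ℝ)⁻¹ • ∑ j, v j with ha
  have hsum : ∑ j, v j = (n : ℝ) • a := by
    rw [ha, smul_smul, mul_inv_cancel₀ (by positivity), one_smul]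
  simp_rw [norm_sub_sq_real, sum_add_distrib, sum_sub_distrib, ← mul_sum, ← sum_inner, hsum,
    real_inner_smul_left, real_inner_self_eq_norm_sq]
  simp only [sum_const, card_univ, Fintype.card_fin, nsmul_eq_mul]
  nlinarith [mul_nonneg (Nat.cast_nonneg (α := ℝ) n) (sq_nonneg ‖a‖)]

include hn hw hw1 in
lemma contraction_factor_mem : 0 < 1 - w / (2 * (n : ℝ) ^ 2) ∧ 1 - w / (2 * (n : ℝ) ^ 2) < 1 := by
  have hn1 : (1 : ℝ) ≤ n := by exact_mod_cast hn
  have h1 : 0 < w / (2 * (n : ℝ) ^ 2) := by positivity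
  have h2 : w / (2 * (n : ℝ) ^ 2) < 1 := by
    rw [div_lt_one (by positivity)]; nlinarith
  constructor <;> linarith

include hn hnn hrow hcol hw hw1 hdiag hpos hN hcut in
/-- Distance to consensus of a perturbed averaging process. -/
lemma sum_norm_mix_sub_avg_le (lam : ℝ) (hl0 : 0 < lam) (hl1 : lam < 1)
    (hlam : lam ^ N = 1 - w / (2 * (n : ℝ) ^ 2))
    (Q ε : ℕ → Fin n → EuclideanSpace ℝ (Fin m)) (hQ0 : ∀ i, Q 0 i = 0)
    (hQ : ∀ t i, Q (t + 1) i = ∑ j, W t i j • Q t j + ε (t + 1) i)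
    (e : ℕ → ℝ) (he : ∀ t, 1 ≤ t → ∀ i, ‖ε t i‖ ≤ e t) (t : ℕ) :
    ∑ i, ‖∑ j, W t i j • Q t j - (n : ℝ)⁻¹ • ∑ j, Q t j‖
      ≤ ∑ s ∈ Icc 1 t, n * e s * (lam ^ (t - s) / (1 - w / (2 * (n : ℝ) ^ 2))) := by
  obtain ⟨hρ0, hρ1⟩ := contraction_factor_mem hn w hw hw1
  set ρ := 1 - w / (2 * (n : ℝ) ^ 2)
  set cen : ℕ → Fin n → EuclideanSpace ℝ (Fin m) :=
    fun s i => ε s i - (n : ℝ)⁻¹ • ∑ j, ε s j with hcen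
  have hn0 : (n : ℝ) ≠ 0 := by positivity
  have hcen0 : ∀ s, ∑ i, cen s i = 0 := by
    intro s
    simp only [hcen, sum_sub_distrib, sum_const, card_univ, Fintype.card_fin]
    rw [← Nat.cast_smul_eq_nsmul ℝ, smul_smul, mul_inv_cancel₀ hn0, one_smul, sub_self]
  have hstep : ∀ t, (∀ i, Q t i - (n : ℝ)⁻¹ • ∑ j, Q t j
      = ∑ s ∈ Icc 1 t, mixIter W s (cen s) (t - s) i) →
      ∀ i, ∑ j, W t i j • Q t j - (n : ℝ)⁻¹ • ∑ j, Q t j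
        = ∑ s ∈ Icc 1 t, mixIter W s (cen s) (t + 1 - s) i := by
    intro t h i
    have h1 : ∑ j, W t i j • Q t j - (n : ℝ)⁻¹ • ∑ j, Q t j
        = ∑ j, W t i j • (Q t j - (n : ℝ)⁻¹ • ∑ j, Q t j) := by
      simp_rw [smul_sub, sum_sub_distrib, ← sum_smul, hrow, one_smul]
    rw [h1]
    simp_rw [h, smul_sum]
    rw [sum_comm]
    refine sum_congr rfl fun s hs => ?_
    rw [mem_Icc] at hs
    rw [show t + 1 - s = (t - s) + 1 by omega]
    simp only [mixIter]
    rw [show s + (t - s) = t by omega]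
  have hrep : ∀ t, ∀ i, Q t i - (n : ℝ)⁻¹ • ∑ j, Q t j
      = ∑ s ∈ Icc 1 t, mixIter W s (cen s) (t - s) i := by
    intro t
    induction t with
    | zero => simp [hQ0]
    | succ t ih =>
      intro i
      rw [sum_Icc_succ_top (by omega), ← hstep t ih i]
      simp only [hQ, sum_add_distrib, sum_mix (W t) (hcol t), smul_add, Nat.sub_self, mixIter, hcen]
      abel
  have hterm : ∀ s ∈ Icc 1 t, ∑ i, ‖mixIter W s (cen s) (t + 1 - s) i‖
      ≤ n * e s * (lam ^ (t - s) / ρ) := by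
    intro s hs
    rw [mem_Icc] at hs
    set k := t + 1 - s
    have hes : 0 ≤ e s := (norm_nonneg _).trans (he s hs.1 ⟨0, hn⟩)
    have h1 := sum_norm_sq_mixIter_le hn W hnn hrow hcol w hw hdiag hpos N hN hcut s (cen s)
      (hcen0 s) k
    have h2 : ∑ i, ‖cen s i‖ ^ 2 ≤ n * e s ^ 2 := by
      refine (sum_norm_sq_sub_avg_le (ε s)).trans ?_
      refine (sum_le_sum fun i _ => pow_le_pow_left₀ (norm_nonneg _) (he s hs.1 i) 2).trans ?_
      simp
    have h3 : ρ ^ (k / N) ≤ lam ^ (t - s) / ρ := by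
      rw [le_div_iff₀ hρ0, ← hlam, ← pow_mul, ← pow_add]
      refine pow_le_pow_of_le_one hl0.le hl1.le ?_
      have := Nat.div_add_mod k N
      have := Nat.mod_lt k hN
      have : k = t + 1 - s := rfl
      omega
    have h4 : (∑ i, ‖mixIter W s (cen s) k i‖) ^ 2 ≤ (n * e s * (lam ^ (t - s) / ρ)) ^ 2 := by
      calc (∑ i, ‖mixIter W s (cen s) k i‖) ^ 2
          ≤ n * ∑ i, ‖mixIter W s (cen s) k i‖ ^ 2 := by
            simpa using sq_sum_le_card_mul_sum_sq (s := (univ : Finset (Fin n)))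
              (f := fun i => ‖mixIter W s (cen s) k i‖)
        _ ≤ n * ((ρ ^ (k / N)) ^ 2 * (n * e s ^ 2)) := by gcongr; exact h1.trans (by gcongr)
        _ ≤ n * ((lam ^ (t - s) / ρ) ^ 2 * (n * e s ^ 2)) := by gcongr
        _ = (n * e s * (lam ^ (t - s) / ρ)) ^ 2 := by ring
    exact (pow_le_pow_iff_left₀ (by positivity) (by positivity) two_ne_zero).1 h4
  calc ∑ i, ‖∑ j, W t i j • Q t j - (n : ℝ)⁻¹ • ∑ j, Q t j‖
      ≤ ∑ i, ∑ s ∈ Icc 1 t, ‖mixIter W s (cen s) (t + 1 - s) i‖ := by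
        refine sum_le_sum fun i _ => ?_
        rw [hstep t (hrep t) i]
        exact norm_sum_le _ _
    _ = ∑ s ∈ Icc 1 t, ∑ i, ‖mixIter W s (cen s) (t + 1 - s) i‖ := sum_comm
    _ ≤ _ := sum_le_sum hterm

end Decay

/-- Summing a geometrically discounted nonnegative sequence. -/
lemma sum_sum_mul_pow_le (e : ℕ → ℝ) (he : ∀ s, 1 ≤ s → 0 ≤ e s) (lam : ℝ) (hl0 : 0 < lam)
    (hl1 : lam < 1) (T : ℕ) :
    ∑ t ∈ Icc 1 T, ∑ s ∈ Icc 1 t, e s * lam ^ (t - s) ≤ (∑ s ∈ Icc 1 T, e s) / (1 - lam) := by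
  rw [sum_comm' (t' := Icc 1 T) (s' := fun s => Icc s T)
    (fun t s => by simp only [mem_Icc]; omega), sum_div]
  refine sum_le_sum fun s hs => ?_
  rw [mem_Icc] at hs
  rw [← mul_sum, div_eq_mul_inv]
  refine mul_le_mul_of_nonneg_left ?_ (he s hs.1)
  have h1 : ∑ t ∈ Icc s T, lam ^ (t - s) = ∑ k ∈ range (T + 1 - s), lam ^ k := by
    rw [← Ico_add_one_right_eq_Icc, sum_Ico_eq_sum_range]
    simp
  rw [h1, ← tsum_geometric_of_lt_one hl0.le hl1]
  exact (summable_geometric_of_lt_one hl0.le hl1).sum_le_tsum _ fun _ _ => pow_nonneg hl0.le _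

end Consensus

section Euclidean

variable {d : ℕ}

@[simp]
lemma posPart_coord (v : EuclideanSpace ℝ (Fin d)) (j : Fin d) :
    posPart v j = max (v j) 0 := rfl

@[simp]
lemma vecOf_coord (v : Fin d → ℝ) (j : Fin d) : vecOf v j = v j := rfl

lemma norm_le_norm_of_abs_coord_le {u v : EuclideanSpace ℝ (Fin d)} (h : ∀ j, |u j| ≤ |v j|) :
    ‖u‖ ≤ ‖v‖ := by
  rw [EuclideanSpace.norm_eq, EuclideanSpace.norm_eq]
  refine Real.sqrt_le_sqrt (Finset.sum_le_sum fun j _ => ?_)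
  exact pow_le_pow_left₀ (abs_nonneg _) (h j) 2

lemma inner_eq_sum_mul (u v : EuclideanSpace ℝ (Fin d)) : ⟪u, v⟫ = ∑ j, u j * v j := by
  rw [PiLp.inner_apply]
  exact Finset.sum_congr rfl fun j _ => by simp [mul_comm]

lemma norm_posPart_sub_le (v u : EuclideanSpace ℝ (Fin d)) (hu : ∀ j, 0 ≤ u j) :
    ‖posPart v - u‖ ≤ ‖v - u‖ := by
  refine norm_le_norm_of_abs_coord_le fun j => ?_
  have := abs_max_sub_max_le_abs (v j) (u j) 0
  rwa [max_eq_left (hu j)] at this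

lemma norm_posPart_le (v : EuclideanSpace ℝ (Fin d)) : ‖posPart v‖ ≤ ‖v‖ := by
  simpa using norm_posPart_sub_le v 0 (by simp)

lemma inner_posPart_self (v : EuclideanSpace ℝ (Fin d)) : ⟪posPart v, v⟫ = ‖posPart v‖ ^ 2 := by
  rw [← real_inner_self_eq_norm_sq, inner_eq_sum_mul, inner_eq_sum_mul]
  refine Finset.sum_congr rfl fun j _ => ?_
  rcases le_total (v j) 0 with h | h <;> simp [h]

lemma inner_le_inner_of_coord_le {q u v : EuclideanSpace ℝ (Fin d)} (hq : ∀ j, 0 ≤ q j)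
    (h : ∀ j, u j ≤ v j) : ⟪q, u⟫ ≤ ⟪q, v⟫ := by
  rw [inner_eq_sum_mul, inner_eq_sum_mul]
  exact Finset.sum_le_sum fun j _ => mul_le_mul_of_nonneg_left (h j) (hq j)

/-- Three-point inequality for a mirror descent step. -/
lemma breg_three_point {X : Set (EuclideanSpace ℝ (Fin d))} (hX : Convex ℝ X)
    {ψ r : EuclideanSpace ℝ (Fin d) → ℝ}
    {ψ' : EuclideanSpace ℝ (Fin d) → EuclideanSpace ℝ (Fin d)} (hr : ConvexOn ℝ X r)
    {α : ℝ} (hα : 0 < α) {a x y z : EuclideanSpace ℝ (Fin d)} (hy : y ∈ X) (hz : z ∈ X)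
    (hψ : HasGradientAt ψ (ψ' y) y)
    (hmin : ∀ v ∈ X, α * ⟪y, a⟫ + α * r y + breg ψ ψ' y x
      ≤ α * ⟪v, a⟫ + α * r v + breg ψ ψ' v x) :
    α * (⟪y - z, a⟫ + r y - r z) ≤ breg ψ ψ' z x - breg ψ ψ' z y - breg ψ ψ' y x := by
  set C := α * (⟪y - z, a⟫ + r y - r z) + ⟪ψ' x, z - y⟫ with hC
  have hder : HasDerivAt (fun s : ℝ => ψ (y + s • (z - y))) ⟪ψ' y, z - y⟫ 0 := by
    have h1 : HasDerivAt (fun s : ℝ => y + s • (z - y)) (z - y) 0 := by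
      simpa using ((hasDerivAt_id (0 : ℝ)).smul_const (z - y)).const_add y
    have h2 : HasFDerivAt ψ (InnerProductSpace.toDual ℝ _ (ψ' y)) (y + (0 : ℝ) • (z - y)) := by
      simpa using hψ.hasFDerivAt
    have h3 := h2.comp_hasDerivAt (0 : ℝ) h1
    rw [InnerProductSpace.toDual_apply_apply] at h3
    exact h3
  have hlim := hder.tendsto_slope_zero_right
  have hCle : C ≤ ⟪ψ' y, z - y⟫ := by
    refine ge_of_tendsto hlim ?_
    filter_upwards [Ioo_mem_nhdsGT (show (0 : ℝ) < 1 by norm_num)] with s hs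
    obtain ⟨hs0, hs1⟩ := hs
    have hmem : y + s • (z - y) ∈ X := hX.add_smul_sub_mem hy hz ⟨hs0.le, hs1.le⟩
    have hrc : r (y + s • (z - y)) ≤ (1 - s) * r y + s * r z := by
      have := hr.2 hy hz (by linarith : (0 : ℝ) ≤ 1 - s) hs0.le (by ring)
      rw [show (1 - s) • y + s • z = y + s • (z - y) by module] at this
      simpa using this
    have h := hmin _ hmem
    have hrα := mul_le_mul_of_nonneg_left hrc hα.le
    simp only [breg] at h
    have e1 : ⟪y + s • (z - y), a⟫ = ⟪y, a⟫ - s * ⟪y - z, a⟫ := by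
      rw [inner_add_left, real_inner_smul_left, inner_sub_left, inner_sub_left]; ring
    have e2 : ⟪ψ' x, y + s • (z - y) - x⟫ = ⟪ψ' x, y - x⟫ + s * ⟪ψ' x, z - y⟫ := by
      rw [show y + s • (z - y) - x = (y - x) + s • (z - y) by abel, inner_add_right,
        real_inner_smul_right]
    rw [e1, e2] at h
    simp only [zero_add, zero_smul, add_zero, smul_eq_mul]
    rw [inv_mul_eq_div, le_div_iff₀ hs0, hC]
    nlinarith
  have e3 : breg ψ ψ' z x - breg ψ ψ' z y - breg ψ ψ' y x
      = ⟪ψ' y, z - y⟫ - ⟪ψ' x, z - y⟫ := by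
    simp only [breg]
    have : ⟪ψ' x, z - x⟫ = ⟪ψ' x, z - y⟫ + ⟪ψ' x, y - x⟫ := by
      rw [← inner_add_right]; congr 1; abel
    linarith
  rw [e3]
  linarith

end Euclidean

namespace Alg

open Finset

variable {n m : ℕ} {p : Fin n → ℕ} (S : Alg n m p)

lemma sigmin_pos : 0 < S.sigmin := by
  simp [sigmin, Finset.lt_inf'_iff, S.hσ]

lemma sigmin_le (i : Fin n) : S.sigmin ≤ S.σ i := Finset.inf'_le _ (mem_univ i)

lemma x_mem (t : ℕ) (i : Fin n) : S.x t i ∈ S.X i := by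
  rcases Nat.eq_zero_or_pos t with rfl | ht
  · exact S.hx0 i
  · rw [S.hx t ht i]
    exact S.hΦmaps t i _ (S.hxtilmem t ht i)

lemma q_nonneg (t : ℕ) (i : Fin n) (j : Fin m) : 0 ≤ S.q t i j := by
  rcases Nat.eq_zero_or_pos t with rfl | ht
  · simp [S.hq0]
  · simp [S.hq t ht i]

lemma qtil_nonneg (t : ℕ) (ht : 1 ≤ t) (i : Fin n) (j : Fin m) : 0 ≤ S.qtil t i j := by
  rw [S.hqtil t ht i]
  simpa using sum_nonneg fun k _ => mul_nonneg (S.hWnonneg (t - 1) i k) (S.q_nonneg (t - 1) k j)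

lemma dist_le_dX (i : Fin n) {u v : EuclideanSpace ℝ (Fin (p i))} (hu : u ∈ S.X i)
    (hv : v ∈ S.X i) : ‖u - v‖ ≤ S.dX := by
  have hmem : ∀ w ∈ S.X i, ∀ k, Function.update (S.x 0) i w k ∈ S.X k := by
    intro w hw k
    rcases eq_or_ne k i with rfl | h
    · simpa using hw
    · simpa [h] using S.hx0 k
  have h := S.hdiam (stack (Function.update (S.x 0) i u)) (stack (Function.update (S.x 0) i v))
    (hmem u hu) (hmem v hv)
  refine le_trans ?_ h
  have h2 := PiLp.norm_apply_le (stack (Function.update (S.x 0) i u)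
    - stack (Function.update (S.x 0) i v)) i
  simpa [stack] using h2

lemma breg_ge (i : Fin n) {u v : EuclideanSpace ℝ (Fin (p i))} (hu : u ∈ S.X i)
    (hv : v ∈ S.X i) : S.sigmin / 2 * ‖u - v‖ ^ 2 ≤ breg (S.ψ i) (S.ψ' i) u v := by
  have h := S.hψstrong i u hu v hv
  have h2 := mul_le_mul_of_nonneg_right (S.sigmin_le i) (sq_nonneg ‖u - v‖)
  simp only [breg]
  linarith

lemma breg_le (i : Fin n) {u v : EuclideanSpace ℝ (Fin (p i))} (hu : u ∈ S.X i)
    (hv : v ∈ S.X i) : breg (S.ψ i) (S.ψ' i) u v ≤ S.K * ‖u - v‖ := by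
  have h := le_of_abs_le (S.hbregLip i u hu v hv v hv)
  simpa [breg] using h

lemma G_mul_norm_sub_le (c : ℝ) (hc : c < 1) (i : Fin n) {u v : EuclideanSpace ℝ (Fin (p i))}
    (hu : u ∈ S.X i) (hv : v ∈ S.X i) :
    S.G * ‖u - v‖ ≤ 4 * S.G ^ 2 / (S.sigmin * (1 - c)) + (1 - c) * (S.dX * S.K) := by
  have h1 := (S.breg_ge i hu hv).trans (S.breg_le i hu hv)
  have h2 := mul_le_mul_of_nonneg_left (S.dist_le_dX i hu hv) S.hK.le
  have hs : 0 < S.sigmin * (1 - c) := mul_pos S.sigmin_pos (by linarith)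
  have h3 : S.G * ‖u - v‖ ≤ 4 * S.G ^ 2 / (S.sigmin * (1 - c))
      + S.sigmin * (1 - c) / 2 * ‖u - v‖ ^ 2 := by
    rw [← sub_le_iff_le_add, le_div_iff₀ hs]
    nlinarith [sq_nonneg (S.sigmin * (1 - c) * ‖u - v‖ - S.G), sq_nonneg S.G]
  have h4 : (1 - c) * (S.sigmin / 2 * ‖u - v‖ ^ 2) ≤ (1 - c) * (S.dX * S.K) :=
    mul_le_mul_of_nonneg_left (by linarith) (by linarith)
  linarith

lemma exists_edge_across_cut (t : ℕ) (P : Fin n → Prop) (h1 : ∃ i, P i) (h2 : ∃ i, ¬ P i) :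
    ∃ l < S.iota, ∃ u v, P u ∧ ¬ P v ∧ 0 < S.W (t + l) v u := by
  obtain ⟨a, ha⟩ := h1
  obtain ⟨b, hb⟩ := h2
  by_contra hcon
  push Not at hcon
  refine hb (Relation.ReflTransGen.rec (motive := fun x _ => P x) ha ?_ (S.hconn t a b))
  rintro u v _ ⟨l, hl, hW⟩ hu
  by_contra hv
  exact absurd hW (not_lt.2 (hcon l hl u v hu hv))

lemma b_coord_le (t : ℕ) (ht : 1 ≤ t) (i : Fin n) (j : Fin m) :
    S.b t i j ≤ S.g (t - 1) i (S.xtil t i) j := by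
  rw [S.hb t ht i]
  have := S.hGgsub (t - 1) i _ (S.x_mem (t - 1) i) j _ (S.hxtilmem t ht i)
  simpa [add_comm] using this

lemma norm_b_le (t : ℕ) (ht : 1 ≤ t) (i : Fin n) : ‖S.b t i‖ ≤ S.F + S.G * S.dX := by
  rw [S.hb t ht i]
  refine (norm_add_le _ _).trans ?_
  have h1 := S.hGgbound (t - 1) i _ (S.x_mem (t - 1) i) (S.xtil t i - S.x (t - 1) i)
  have h2 := S.hgbound (t - 1) i _ (S.x_mem (t - 1) i)
  have h3 := mul_le_mul_of_nonneg_left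
    (S.dist_le_dX i (S.hxtilmem t ht i) (S.x_mem (t - 1) i)) S.hG.le
  linarith

lemma q_one (i : Fin n) : S.q 1 i = 0 := by
  have hqt : S.qtil 1 i = 0 := by simp [S.hqtil 1 le_rfl i, S.hq0]
  ext j
  have hb : S.b 1 i j ≤ 0 := by simpa [S.hg0] using S.b_coord_le 1 le_rfl i j
  simp [S.hq 1 le_rfl i, hqt, mul_nonpos_of_nonneg_of_nonpos (S.hγpos 1 le_rfl).le hb]

lemma norm_mix_le {E : Type*} [SeminormedAddCommGroup E] [NormedSpace ℝ E] (t : ℕ) (i : Fin n)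
    (v : Fin n → E) (c : ℝ) (hv : ∀ j, ‖v j‖ ≤ c) : ‖∑ j, S.W t i j • v j‖ ≤ c := by
  calc ‖∑ j, S.W t i j • v j‖ ≤ ∑ j, ‖S.W t i j • v j‖ := norm_sum_le _ _
    _ ≤ ∑ j, S.W t i j * c := by
      refine sum_le_sum fun j _ => ?_
      rw [norm_smul, Real.norm_of_nonneg (S.hWnonneg t i j)]
      exact mul_le_mul_of_nonneg_left (hv j) (S.hWnonneg t i j)
    _ = c := by rw [← sum_mul, S.hWrow, one_mul]

lemma norm_q_le_of_qtil (t : ℕ) (ht : 1 ≤ t) (hγβ : S.β t * S.γ t ≤ 1) (i : Fin n) :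
    ‖S.q t i‖ ≤ (1 - S.β t * S.γ t) * ‖S.qtil t i‖ + S.γ t * S.F := by
  have hγ := S.hγpos t ht
  have h1 : ‖S.q t i‖ ≤ ‖(1 - S.β t * S.γ t) • S.qtil t i
      + S.γ t • posPart (S.g (t - 1) i (S.xtil t i))‖ := by
    refine norm_le_norm_of_abs_coord_le fun j => ?_
    rw [abs_of_nonneg (S.q_nonneg t i j)]
    refine le_trans ?_ (le_abs_self _)
    have h0 := mul_nonneg (sub_nonneg.2 hγβ) (S.qtil_nonneg t ht i j)
    have hg := mul_le_mul_of_nonneg_left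
      ((S.b_coord_le t ht i j).trans (le_max_left _ 0)) hγ.le
    have hg0 := mul_nonneg hγ.le (le_max_right (S.g (t - 1) i (S.xtil t i) j) 0)
    simp only [S.hq t ht i, posPart_coord, PiLp.add_apply, PiLp.smul_apply, PiLp.sub_apply,
      smul_eq_mul]
    refine max_le ?_ ?_ <;> nlinarith
  refine h1.trans ((norm_add_le _ _).trans ?_)
  rw [norm_smul, norm_smul, Real.norm_of_nonneg (sub_nonneg.2 hγβ), Real.norm_of_nonneg hγ.le]
  have := (norm_posPart_le (S.g (t - 1) i (S.xtil t i))).trans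
    (S.hgbound (t - 1) i _ (S.hxtilmem t ht i))
  gcongr

lemma β_mul_norm_qtil_le (hγβ : ∀ t, 1 ≤ t → S.β t * S.γ t ≤ 1) (t : ℕ) (i : Fin n) :
    S.β (t + 1) * ‖S.qtil (t + 1) i‖ ≤ S.F := by
  have hmix : ∀ t, (∀ i, S.β (t + 1) * ‖S.q t i‖ ≤ S.F) →
      ∀ i, S.β (t + 1) * ‖S.qtil (t + 1) i‖ ≤ S.F := by
    intro t h i
    have hβ := S.hβpos (t + 1) (by omega)
    rw [← le_div_iff₀' hβ, S.hqtil (t + 1) (by omega)]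
    exact S.norm_mix_le _ _ _ _ fun j => (le_div_iff₀' hβ).2 (h j)
  refine hmix t ?_ i
  induction t with
  | zero => simp [S.hq0, S.hF.le]
  | succ t ih =>
    intro i
    have h1 := hmix t ih i
    have h2 := S.norm_q_le_of_qtil (t + 1) (by omega) (hγβ _ (by omega)) i
    have hβ := S.hβpos (t + 1) (by omega)
    have hanti := mul_le_mul_of_nonneg_right
      (S.hβanti (t + 1) (t + 1 + 1) (by omega) (by omega)) (norm_nonneg (S.q (t + 1) i))
    have h3 := mul_le_mul_of_nonneg_left h2 hβ.le
    have h4 := mul_le_mul_of_nonneg_left h1 (sub_nonneg.2 (hγβ (t + 1) (by omega)))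
    linarith

lemma norm_dual_direction_le (hγβ : ∀ t, 1 ≤ t → S.β t * S.γ t ≤ 1) (t : ℕ) (ht : 1 ≤ t)
    (i : Fin n) : ‖S.b t i - S.β t • S.qtil t i‖ ≤ S.B1 := by
  obtain ⟨t, rfl⟩ : ∃ k, t = k + 1 := ⟨t - 1, by omega⟩
  refine (norm_sub_le _ _).trans ?_
  rw [norm_smul, Real.norm_of_nonneg (S.hβpos _ ht).le, B1]
  linarith [S.norm_b_le (t + 1) ht i, S.β_mul_norm_qtil_le hγβ t i]

lemma B1_pos : 0 < S.B1 := by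
  have := S.hF
  have := mul_pos S.hG S.hdX
  rw [B1]; linarith

/-- Cumulative distance to consensus of the mixed dual variables. -/
lemma sum_consensus_error_le (hγβ : ∀ t, 1 ≤ t → S.β t * S.γ t ≤ 1) (T : ℕ) :
    0 < S.lam ∧ S.lam < 1 ∧ 0 < 1 - S.w / (2 * (n : ℝ) ^ 2) ∧
    1 - S.w / (2 * (n : ℝ) ^ 2) < 1 ∧
    ∑ t ∈ Icc 1 T, ∑ i, ‖S.qtil (t + 1) i - S.qbar t‖
      ≤ n * S.B1 / ((1 - S.w / (2 * (n : ℝ) ^ 2)) * (1 - S.lam)) * ∑ t ∈ Icc 1 T, S.γ t := by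
  obtain ⟨hρ0, hρ1⟩ := contraction_factor_mem S.hn S.w S.hw0 S.hw1
  have hl0 : 0 < S.lam := Real.rpow_pos_of_pos hρ0 _
  have hι : (0 : ℝ) < S.iota := by exact_mod_cast S.hiota
  have hl1 : S.lam < 1 := Real.rpow_lt_one hρ0.le hρ1 (inv_pos.2 hι)
  have hpow : S.lam ^ S.iota = 1 - S.w / (2 * (n : ℝ) ^ 2) :=
    Real.rpow_inv_natCast_pow hρ0.le S.hiota.ne'
  refine ⟨hl0, hl1, hρ0, hρ1, ?_⟩
  have hstep := sum_norm_mix_sub_avg_le S.hn S.W S.hWnonneg S.hWrow S.hWcol S.w S.hw0 S.hw1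
    S.hWdiag S.hWpos S.iota S.hiota S.exists_edge_across_cut S.lam hl0 hl1 hpow S.q
    (fun t i => S.q t i - S.qtil t i) S.hq0
    (fun t i => by simp [S.hqtil (t + 1) (by omega) i]) (fun t => S.γ t * S.B1) ?_
  · set ρ := 1 - S.w / (2 * (n : ℝ) ^ 2)
    calc ∑ t ∈ Icc 1 T, ∑ i, ‖S.qtil (t + 1) i - S.qbar t‖
        ≤ ∑ t ∈ Icc 1 T, ∑ s ∈ Icc 1 t, n * (S.γ s * S.B1) * (S.lam ^ (t - s) / ρ) := by
          refine sum_le_sum fun t _ => ?_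
          have := hstep t
          simpa only [S.hqtil (t + 1) (by omega), qbar, Nat.add_sub_cancel] using this
      _ = n * S.B1 / ρ * ∑ t ∈ Icc 1 T, ∑ s ∈ Icc 1 t, S.γ s * S.lam ^ (t - s) := by
          simp_rw [mul_sum]
          refine sum_congr rfl fun t _ => sum_congr rfl fun s _ => by ring
      _ ≤ n * S.B1 / ρ * ((∑ t ∈ Icc 1 T, S.γ t) / (1 - S.lam)) := by
          refine mul_le_mul_of_nonneg_left ?_ ?_
          · exact sum_sum_mul_pow_le S.γ (fun s hs => (S.hγpos s hs).le) S.lam hl0 hl1 T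
          · exact div_nonneg (mul_nonneg (Nat.cast_nonneg n) S.B1_pos.le) hρ0.le
      _ = _ := by
          rw [div_mul_div_comm, div_mul_eq_mul_div]
  · intro t ht i
    rw [S.hq t ht i]
    refine (norm_posPart_sub_le _ _ (S.qtil_nonneg t ht i)).trans ?_
    rw [add_sub_cancel_left, norm_smul, Real.norm_of_nonneg (S.hγpos t ht).le]
    exact mul_le_mul_of_nonneg_left (S.norm_dual_direction_le hγβ t ht i) (S.hγpos t ht).le

lemma primal_step_le (e : ℝ)
    (he : ∀ i, ∀ u ∈ S.X i, ∀ v ∈ S.X i, S.G * ‖u - v‖ ≤ e) (t : ℕ) (i : Fin n)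
    {y : EuclideanSpace ℝ (Fin (p i))} (hy : y ∈ S.X i) :
    ⟪S.qtil (t + 1) i, S.b (t + 1) i⟫ ≤ ⟪S.qtil (t + 1) i, S.g t i y⟫ + 2 * S.F + e
      + (S.α (t + 1))⁻¹ * (breg (S.ψ i) (S.ψ' i) y (S.x t i)
        - breg (S.ψ i) (S.ψ' i) y (S.xtil (t + 1) i))
      - S.sigmin / (2 * S.α (t + 1)) * ‖S.xtil (t + 1) i - S.x t i‖ ^ 2 := by
  have ht : 1 ≤ t + 1 := by omega
  have hα := S.hαpos _ ht
  have hx := S.x_mem t i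
  have hxt := S.hxtilmem _ ht i
  have h3 := breg_three_point (S.hXconvex i) (S.hrconvex t i) hα hxt hy (S.hψgrad i _)
    (S.hxtilmin _ ht i)
  simp only [Nat.add_sub_cancel] at h3
  have hD := S.breg_ge i hxt hx
  set xt := S.xtil (t + 1) i
  set x := S.x t i
  set Q := S.qtil (t + 1) i
  have hr : -(2 * S.F) ≤ S.r t i xt - S.r t i y := by
    have h1 := neg_le_of_abs_le (S.hrbound t i xt hxt)
    have h2 := le_of_abs_le (S.hrbound t i y hy)
    linarith
  have hf : -e ≤ ⟪xt - y, S.Gf t i x⟫ := by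
    have h1 := neg_le_of_abs_le (abs_real_inner_le_norm (xt - y) (S.Gf t i x))
    have h2 := mul_le_mul_of_nonneg_left (S.hGfbound t i x hx) (norm_nonneg (xt - y))
    have h3 := he i xt hxt y hy
    linarith
  have ha : ⟪xt - y, S.a (t + 1) i⟫ = ⟪xt - y, S.Gf t i x⟫
      + ∑ j, Q j * ⟪S.Gg t i x j, xt - y⟫ := by
    rw [S.ha _ ht, inner_add_right, inner_sum]
    congr 1
    refine sum_congr rfl fun j _ => ?_
    rw [real_inner_smul_right, real_inner_comm]
    rfl
  have hb : ⟪Q, S.b (t + 1) i⟫ - ⟪Q, S.g t i y⟫ ≤ ∑ j, Q j * ⟪S.Gg t i x j, xt - y⟫ := by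
    rw [inner_eq_sum_mul, inner_eq_sum_mul, ← sum_sub_distrib]
    refine sum_le_sum fun j _ => ?_
    rw [← mul_sub]
    refine mul_le_mul_of_nonneg_left ?_ (S.qtil_nonneg _ ht i j)
    have h1 := S.hGgsub t i x hx j y hy
    have h2 : ⟪S.Gg t i x j, xt - y⟫ = ⟪S.Gg t i x j, xt - x⟫ - ⟪S.Gg t i x j, y - x⟫ := by
      rw [← inner_sub_right]; congr 1; abel
    rw [S.hb _ ht, h2]
    simp only [Nat.add_sub_cancel, PiLp.add_apply, vecOf_coord]
    linarith
  have h4 : S.α (t + 1) * (⟪Q, S.b (t + 1) i⟫ - ⟪Q, S.g t i y⟫ - 2 * S.F - e)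
      ≤ S.α (t + 1) * (⟪xt - y, S.a (t + 1) i⟫ + S.r t i xt - S.r t i y) :=
    mul_le_mul_of_nonneg_left (by linarith) hα.le
  have h5 : S.α (t + 1) * (⟪Q, S.b (t + 1) i⟫ - ⟪Q, S.g t i y⟫ - 2 * S.F - e)
      ≤ breg (S.ψ i) (S.ψ' i) y x - breg (S.ψ i) (S.ψ' i) y xt
        - S.sigmin / 2 * ‖xt - x‖ ^ 2 := by linarith
  rw [← le_div_iff₀' hα] at h5
  have h6 : (breg (S.ψ i) (S.ψ' i) y x - breg (S.ψ i) (S.ψ' i) y xt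
        - S.sigmin / 2 * ‖xt - x‖ ^ 2) / S.α (t + 1)
      = (S.α (t + 1))⁻¹ * (breg (S.ψ i) (S.ψ' i) y x - breg (S.ψ i) (S.ψ' i) y xt)
        - S.sigmin / (2 * S.α (t + 1)) * ‖xt - x‖ ^ 2 := by
    field_simp
  linarith

lemma dual_step_le (hγβ : ∀ t, 1 ≤ t → S.β t * S.γ t ≤ 1) (t : ℕ) (ht : 1 ≤ t)
    (v : EuclideanSpace ℝ (Fin m)) (hv : ∀ j, 0 ≤ v j) (i : Fin n) :
    (2 * S.γ t)⁻¹ * (‖S.q t i - v‖ ^ 2 - (1 - S.β t * S.γ t) * ‖S.qtil t i - v‖ ^ 2)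
      ≤ S.β t / 2 * ‖v‖ ^ 2 + ⟪S.qtil t i - v, S.b t i⟫ + S.γ t / 2 * S.B1 ^ 2 := by
  have hγ := S.hγpos t ht
  have hβ := S.hβpos t ht
  have h1 : ‖S.q t i - v‖ ^ 2
      ≤ ‖(S.qtil t i - v) + S.γ t • (S.b t i - S.β t • S.qtil t i)‖ ^ 2 := by
    refine pow_le_pow_left₀ (norm_nonneg _) ?_ 2
    rw [S.hq t ht i]
    refine (norm_posPart_sub_le _ v hv).trans_eq ?_
    congr 1; abel
  have h2 := pow_le_pow_left₀ (norm_nonneg _) (S.norm_dual_direction_le hγβ t ht i) 2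
  have h3 : ⟪S.qtil t i - v, S.b t i - S.β t • S.qtil t i⟫
      = ⟪S.qtil t i - v, S.b t i⟫ - S.β t * ⟪S.qtil t i - v, S.qtil t i⟫ := by
    rw [inner_sub_right, real_inner_smul_right]
  have h4 : ‖v‖ ^ 2 = ‖S.qtil t i‖ ^ 2 - 2 * ⟪S.qtil t i - v, S.qtil t i⟫
      + ‖S.qtil t i - v‖ ^ 2 := by
    have h := norm_sub_sq_real (S.qtil t i) (S.qtil t i - v)
    rw [sub_sub_cancel] at h
    rw [h, real_inner_comm]
  rw [norm_add_sq_real, norm_smul, Real.norm_of_nonneg hγ.le, mul_pow, real_inner_smul_right,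
    h3] at h1
  rw [inv_mul_eq_div, div_le_iff₀ (by positivity)]
  have h5 : 0 ≤ S.β t * S.γ t * ‖S.qtil t i‖ ^ 2 := by positivity
  have h6 := mul_le_mul_of_nonneg_left h2 (sq_nonneg (S.γ t))
  have h7 : S.β t * S.γ t * ‖v‖ ^ 2 = S.β t * S.γ t * (‖S.qtil t i‖ ^ 2
      - 2 * ⟪S.qtil t i - v, S.qtil t i⟫ + ‖S.qtil t i - v‖ ^ 2) := by rw [h4]
  nlinarith

lemma agent_step_le (hγβ : ∀ t, 1 ≤ t → S.β t * S.γ t ≤ 1) (e : ℝ)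
    (he : ∀ i, ∀ u ∈ S.X i, ∀ v ∈ S.X i, S.G * ‖u - v‖ ≤ e) (t : ℕ)
    (v : EuclideanSpace ℝ (Fin m)) (hv : ∀ j, 0 ≤ v j) (i : Fin n)
    {y : EuclideanSpace ℝ (Fin (p i))} (hy : y ∈ S.X i) :
    (2 * S.γ (t + 1))⁻¹ * (‖S.q (t + 1) i - v‖ ^ 2
        - (1 - S.β (t + 1) * S.γ (t + 1)) * ‖S.qtil (t + 1) i - v‖ ^ 2)
        + ⟪v, S.g t i (S.x t i)⟫
      ≤ (S.β (t + 1) / 2 + S.α (t + 1) * (S.G ^ 2 / (2 * S.sigmin))) * ‖v‖ ^ 2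
        + S.γ (t + 1) / 2 * S.B1 ^ 2
        + ⟪S.qtil (t + 1) i, S.g t i y⟫ + (2 * S.F + e)
        + (S.α (t + 1))⁻¹ * (breg (S.ψ i) (S.ψ' i) y (S.x t i)
          - breg (S.ψ i) (S.ψ' i) y (S.xtil (t + 1) i)) := by
  have ht : 1 ≤ t + 1 := by omega
  have hα := S.hαpos _ ht
  have hσ := S.sigmin_pos
  have h1 := S.dual_step_le hγβ _ ht v hv i
  have h2 := S.primal_step_le e he t i hy
  set δ := ‖S.xtil (t + 1) i - S.x t i‖ with hδ
  have h3 : -⟪v, S.b (t + 1) i⟫ ≤ -⟪v, S.g t i (S.x t i)⟫ + ‖v‖ * (S.G * δ) := by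
    rw [S.hb _ ht, inner_add_right]
    simp only [Nat.add_sub_cancel]
    have h := neg_le_of_abs_le (abs_real_inner_le_norm v
      (vecOf fun j => ⟪S.Gg t i (S.x t i) j, S.xtil (t + 1) i - S.x t i⟫))
    have h' := mul_le_mul_of_nonneg_left (S.hGgbound t i _ (S.x_mem t i)
      (S.xtil (t + 1) i - S.x t i)) (norm_nonneg v)
    linarith
  have h4 : ‖v‖ * (S.G * δ) ≤ S.α (t + 1) * (S.G ^ 2 / (2 * S.sigmin)) * ‖v‖ ^ 2
      + S.sigmin / (2 * S.α (t + 1)) * δ ^ 2 := by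
    have h : S.α (t + 1) * (S.G ^ 2 / (2 * S.sigmin)) * ‖v‖ ^ 2
      + S.sigmin / (2 * S.α (t + 1)) * δ ^ 2 - ‖v‖ * (S.G * δ)
      = (S.α (t + 1) * S.G * ‖v‖ - S.sigmin * δ) ^ 2 / (2 * S.α (t + 1) * S.sigmin) := by
      field_simp
      ring
    have h' : 0 ≤ (S.α (t + 1) * S.G * ‖v‖ - S.sigmin * δ) ^ 2
      / (2 * S.α (t + 1) * S.sigmin) := by positivity
    linarith
  rw [inner_sub_left] at h1
  linarith

/-- One step of the combined primal-dual estimate, summed over the agents. -/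
lemma network_step_le (hγβ : ∀ t, 1 ≤ t → S.β t * S.γ t ≤ 1) (e : ℝ)
    (he : ∀ i, ∀ u ∈ S.X i, ∀ v ∈ S.X i, S.G * ‖u - v‖ ≤ e) (t : ℕ)
    (v : EuclideanSpace ℝ (Fin m)) (hv : ∀ j, 0 ≤ v j)
    (y y' : ∀ i, EuclideanSpace ℝ (Fin (p i))) (hy : ∀ i, y i ∈ S.X i)
    (hy' : ∀ i, y' i ∈ S.X i) (hfeas : ∀ j, S.gsum t y j ≤ 0) :
    (2 * S.γ (t + 1))⁻¹ * (∑ i, ‖S.q (t + 1) i - v‖ ^ 2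
        - (1 - S.β (t + 1) * S.γ (t + 1)) * ∑ i, ‖S.q t i - v‖ ^ 2)
        + ⟪v, S.gsum t (S.x t)⟫
      ≤ n * ((S.β (t + 1) / 2 + S.α (t + 1) * (S.G ^ 2 / (2 * S.sigmin))) * ‖v‖ ^ 2
        + S.γ (t + 1) / 2 * S.B1 ^ 2 + (2 * S.F + e))
        + S.F * ∑ i, ‖S.qtil (t + 1) i - S.qbar t‖
        + (S.α (t + 1))⁻¹ * (∑ i, breg (S.ψ i) (S.ψ' i) (y i) (S.x t i)
          - ∑ i, breg (S.ψ i) (S.ψ' i) (y' i) (S.x (t + 1) i))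
        + (S.α (t + 1))⁻¹ * S.K * ∑ i, ‖y' i - S.Φ (t + 1) i (y i)‖ := by
  have ht : 1 ≤ t + 1 := by omega
  have hα := S.hαpos _ ht
  have hγ := S.hγpos _ ht
  have hsum := sum_le_sum (s := univ) fun i _ => S.agent_step_le hγβ e he t v hv i (hy i)
  simp only [sum_add_distrib, sum_sub_distrib, ← mul_sum, ← inner_sum, sum_const, card_univ,
    Fintype.card_fin, nsmul_eq_mul] at hsum
  have hg : ∑ i, ⟪S.qtil (t + 1) i, S.g t i (y i)⟫
      ≤ S.F * ∑ i, ‖S.qtil (t + 1) i - S.qbar t‖ := by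
    have h1 : ∑ i, ⟪S.qtil (t + 1) i, S.g t i (y i)⟫
        = ∑ i, ⟪S.qtil (t + 1) i - S.qbar t, S.g t i (y i)⟫ + ⟪S.qbar t, S.gsum t y⟫ := by
      simp_rw [inner_sub_left, sum_sub_distrib, gsum, inner_sum]
      ring
    have h2 : ⟪S.qbar t, S.gsum t y⟫ ≤ 0 := by
      have hq : ∀ j, 0 ≤ S.qbar t j := by
        intro j
        have := mul_nonneg (inv_nonneg.2 (Nat.cast_nonneg (α := ℝ) n))
          (sum_nonneg fun i (_ : i ∈ univ) => S.q_nonneg t i j)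
        simpa [qbar] using this
      have := inner_le_inner_of_coord_le (v := 0) hq (by simpa using hfeas)
      simpa using this
    rw [h1, mul_sum]
    have h3 : ∑ i, ⟪S.qtil (t + 1) i - S.qbar t, S.g t i (y i)⟫
        ≤ ∑ i, S.F * ‖S.qtil (t + 1) i - S.qbar t‖ := by
      refine sum_le_sum fun i _ => (real_inner_le_norm _ _).trans ?_
      rw [mul_comm]
      exact mul_le_mul_of_nonneg_right (S.hgbound t i _ (hy i)) (norm_nonneg _)
    linarith
  have hmix : ∑ i, ‖S.qtil (t + 1) i - v‖ ^ 2 ≤ ∑ i, ‖S.q t i - v‖ ^ 2 := by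
    refine le_of_eq_of_le (sum_congr rfl fun i _ => ?_)
      (sum_norm_sq_mix_le S.W S.hWnonneg S.hWrow S.hWcol t fun i => S.q t i - v)
    simp_rw [smul_sub, sum_sub_distrib, ← sum_smul, S.hWrow, one_smul, S.hqtil _ ht i,
      Nat.add_sub_cancel]
  have hD : ∑ i, breg (S.ψ i) (S.ψ' i) (y' i) (S.x (t + 1) i)
      - S.K * ∑ i, ‖y' i - S.Φ (t + 1) i (y i)‖
      ≤ ∑ i, breg (S.ψ i) (S.ψ' i) (y i) (S.xtil (t + 1) i) := by
    rw [mul_sum, ← sum_sub_distrib]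
    refine sum_le_sum fun i _ => ?_
    have h1 := S.hΦcontract (t + 1) i _ (hy i) _ (S.hxtilmem _ ht i)
    have h2 := le_of_abs_le (S.hbregLip i _ (hy' i) _ (S.hΦmaps (t + 1) i _ (hy i)) _
      (S.x_mem (t + 1) i))
    rw [← S.hx _ ht i] at h1
    linarith
  have hD' := mul_le_mul_of_nonneg_left hD (inv_pos.2 hα).le
  have hmix' := mul_le_mul_of_nonneg_left hmix
    (mul_nonneg (inv_pos.2 (show 0 < 2 * S.γ (t + 1) by positivity)).le
      (sub_nonneg.2 (hγβ _ ht)))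
  rw [show S.gsum t (S.x t) = ∑ i, S.g t i (S.x t i) from rfl]
  linarith

lemma sum_mul_sub_succ_le (c D : ℕ → ℝ) (M : ℝ) (hc0 : 0 ≤ c 1)
    (hc : ∀ t, 1 ≤ t → c t ≤ c (t + 1)) (hD0 : ∀ t, 1 ≤ t → 0 ≤ D t) (hD : ∀ t, 1 ≤ t → D t ≤ M)
    (T : ℕ) : ∑ t ∈ Icc 1 T, c (t + 1) * (D t - D (t + 1)) ≤ c (T + 1) * M := by
  have key : ∑ t ∈ Icc 1 T, c (t + 1) * (D t - D (t + 1)) ≤ c (T + 1) * (M - D (T + 1))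
      ∧ 0 ≤ c (T + 1) := by
    induction T with
    | zero => simpa using ⟨mul_nonneg hc0 (sub_nonneg.2 (hD 1 le_rfl)), hc0⟩
    | succ T ih =>
      rw [sum_Icc_succ_top (by omega)]
      have h := hc (T + 1) (by omega)
      have h' := mul_le_mul_of_nonneg_right h (sub_nonneg.2 (hD (T + 1) (by omega)))
      exact ⟨by linarith [ih.1], ih.2.trans h⟩
  have := mul_nonneg key.2 (hD0 (T + 1) (by omega))
  linarith [key.1]

lemma neg_le_sum_mul_sub_succ (c d A : ℕ → ℝ) (hc : ∀ t, 1 ≤ t → 0 ≤ c t)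
    (hd : ∀ t, 1 ≤ t → c (t + 1) * d (t + 1) ≤ c t) (hA : ∀ t, 0 ≤ A t)
    (T : ℕ) : -(c 1 * A 1) ≤ ∑ t ∈ Icc 1 T, c (t + 1) * (A (t + 1) - d (t + 1) * A t) := by
  have key : c (T + 1) * A (T + 1) - c 1 * A 1
      ≤ ∑ t ∈ Icc 1 T, c (t + 1) * (A (t + 1) - d (t + 1) * A t) := by
    induction T with
    | zero => simp
    | succ T ih =>
      rw [sum_Icc_succ_top (by omega)]
      have h := mul_le_mul_of_nonneg_right (hd (T + 1) (by omega)) (hA (T + 1))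
      linarith
  have := mul_nonneg (hc (T + 1) (by omega)) (hA (T + 1))
  linarith

/-- Cumulative primal-dual estimate against a feasible comparator. -/
lemma inner_sum_gsum_le (hγβ : ∀ t, 1 ≤ t → S.β t * S.γ t ≤ 1)
    (hγstep : ∀ t, 1 ≤ t → (S.γ (t + 1))⁻¹ - S.β (t + 1) ≤ (S.γ t)⁻¹) (e : ℝ)
    (he : ∀ i, ∀ u ∈ S.X i, ∀ v ∈ S.X i, S.G * ‖u - v‖ ≤ e) (T : ℕ) (hT : 1 ≤ T)
    (y : ℕ → ∀ i, EuclideanSpace ℝ (Fin (p i))) (hy : S.Feasible T y)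
    (v : EuclideanSpace ℝ (Fin m)) (hv : ∀ j, 0 ≤ v j) :
    ⟪v, ∑ t ∈ Icc 1 T, S.gsum t (S.x t)⟫
      ≤ n / 2 * (∑ t ∈ Icc 1 T, S.β t + S.G ^ 2 / S.sigmin * ∑ t ∈ Icc 1 T, S.α t
          + (S.γ 1)⁻¹) * ‖v‖ ^ 2
        + (n * S.B1 ^ 2 / 2
          + S.F * (n * S.B1 / ((1 - S.w / (2 * (n : ℝ) ^ 2)) * (1 - S.lam))))
            * ∑ t ∈ Icc 1 T, S.γ t
        + n * (2 * S.F + e) * T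
        + (S.α (T + 1))⁻¹ * (n * (S.K * S.dX))
        + (S.α T)⁻¹ * S.K * S.VPhi T y := by
  have hσ := S.sigmin_pos
  obtain ⟨-, -, -, -, hcons⟩ := S.sum_consensus_error_le hγβ T
  set Y : ℕ → ∀ i, EuclideanSpace ℝ (Fin (p i)) :=
    fun t i => if t ≤ T then y t i else S.Φ t i (y T i) with hY
  have hYle : ∀ t, t ≤ T → Y t = y t := fun t ht => by simp [hY, ht]
  have hYT : Y (T + 1) = fun i => S.Φ (T + 1) i (y T i) := by simp [hY]
  have hYmem : ∀ t, 1 ≤ t → ∀ i, Y t i ∈ S.X i := by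
    intro t ht i
    simp only [hY]
    split_ifs with h
    · exact (hy t (mem_Icc.2 ⟨ht, h⟩)).1 i
    · exact S.hΦmaps t i _ ((hy T (mem_Icc.2 ⟨hT, le_rfl⟩)).1 i)
  set D : ℕ → ℝ := fun t => ∑ i, breg (S.ψ i) (S.ψ' i) (Y t i) (S.x t i) with hD
  set A : ℕ → ℝ := fun t => ∑ i, ‖S.q t i - v‖ ^ 2 with hA
  have hstep : ∀ t ∈ Icc 1 T, (2 * S.γ (t + 1))⁻¹
        * (A (t + 1) - (1 - S.β (t + 1) * S.γ (t + 1)) * A t) + ⟪v, S.gsum t (S.x t)⟫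
      ≤ n / 2 * (S.β t + S.G ^ 2 / S.sigmin * S.α t) * ‖v‖ ^ 2
        + n * S.B1 ^ 2 / 2 * S.γ t + n * (2 * S.F + e)
        + S.F * ∑ i, ‖S.qtil (t + 1) i - S.qbar t‖
        + (S.α (t + 1))⁻¹ * (D t - D (t + 1))
        + (S.α (t + 1))⁻¹ * S.K * ∑ i, ‖Y (t + 1) i - S.Φ (t + 1) i (Y t i)‖ := by
    intro t ht
    have ht' := mem_Icc.1 ht
    have h := S.network_step_le hγβ e he t v hv (Y t) (Y (t + 1)) (hYmem t ht'.1)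
      (hYmem (t + 1) (by omega)) (by rw [hYle t ht'.2]; exact (hy t ht).2)
    have hβ := S.hβanti t (t + 1) ht'.1 (by omega)
    have hα := S.hαanti t (t + 1) ht'.1 (by omega)
    have hγ := S.hγanti t (t + 1) ht'.1 (by omega)
    have h1 : (S.β (t + 1) / 2 + S.α (t + 1) * (S.G ^ 2 / (2 * S.sigmin))) * ‖v‖ ^ 2
        + S.γ (t + 1) / 2 * S.B1 ^ 2 + (2 * S.F + e)
        ≤ (S.β t / 2 + S.α t * (S.G ^ 2 / (2 * S.sigmin))) * ‖v‖ ^ 2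
        + S.γ t / 2 * S.B1 ^ 2 + (2 * S.F + e) := by gcongr
    have h2 := mul_le_mul_of_nonneg_left h1 (Nat.cast_nonneg (α := ℝ) n)
    have h3 : (n : ℝ) * ((S.β t / 2 + S.α t * (S.G ^ 2 / (2 * S.sigmin))) * ‖v‖ ^ 2
        + S.γ t / 2 * S.B1 ^ 2 + (2 * S.F + e))
        = n / 2 * (S.β t + S.G ^ 2 / S.sigmin * S.α t) * ‖v‖ ^ 2
        + n * S.B1 ^ 2 / 2 * S.γ t + n * (2 * S.F + e) := by
      field_simp
    linarith
  have hsum := sum_le_sum hstep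
  simp only [sum_add_distrib, ← mul_sum, ← sum_mul, ← inner_sum, sum_const, Nat.card_Icc,
    Nat.add_sub_cancel, nsmul_eq_mul] at hsum
  have hdual := neg_le_sum_mul_sub_succ (fun t => (2 * S.γ t)⁻¹)
    (fun t => 1 - S.β t * S.γ t) A
    (fun t ht => by have := S.hγpos t ht; positivity) (fun t ht => by
      have h1 := S.hγpos t ht
      have h2 := S.hγpos (t + 1) (by omega)
      have h3 := hγstep t ht
      have h4 : (2 * S.γ (t + 1))⁻¹ * (1 - S.β (t + 1) * S.γ (t + 1))
        = ((S.γ (t + 1))⁻¹ - S.β (t + 1)) / 2 := by field_simp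
      rw [h4, mul_inv]
      linarith) (fun t => sum_nonneg fun i _ => sq_nonneg _) T
  have hA1 : A 1 = n * ‖v‖ ^ 2 := by simp [hA, S.q_one]
  have hprimal := sum_mul_sub_succ_le (fun t => (S.α t)⁻¹) D (n * (S.K * S.dX))
    (inv_pos.2 (S.hαpos 1 le_rfl)).le
    (fun t ht => inv_anti₀ (S.hαpos (t + 1) (by omega)) (S.hαanti t (t + 1) ht (by omega)))
    ?_ ?_ T
  rotate_left
  · intro t ht
    exact sum_nonneg fun i _ => le_trans (mul_nonneg (by linarith) (sq_nonneg _))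
      (S.breg_ge i (hYmem t ht i) (S.x_mem t i))
  · intro t ht
    have : ∀ i ∈ univ, breg (S.ψ i) (S.ψ' i) (Y t i) (S.x t i) ≤ S.K * S.dX := fun i _ =>
      (S.breg_le i (hYmem t ht i) (S.x_mem t i)).trans
        (mul_le_mul_of_nonneg_left (S.dist_le_dX i (hYmem t ht i) (S.x_mem t i)) S.hK.le)
    simpa [hD] using sum_le_sum this
  have hV : ∑ t ∈ Icc 1 T, (S.α (t + 1))⁻¹ * S.K * ∑ i, ‖Y (t + 1) i - S.Φ (t + 1) i (Y t i)‖
      ≤ (S.α T)⁻¹ * S.K * S.VPhi T y := by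
    obtain ⟨T, rfl⟩ : ∃ k, T = k + 1 := ⟨T - 1, by omega⟩
    rw [sum_Icc_succ_top (by omega), hYT, hYle _ le_rfl, VPhi, Nat.add_sub_cancel]
    simp only [sub_self, norm_zero, sum_const_zero, mul_zero, add_zero]
    rw [mul_sum]
    refine sum_le_sum fun t ht => ?_
    have ht' := mem_Icc.1 ht
    rw [hYle t (by omega), hYle (t + 1) (by omega)]
    have h := inv_anti₀ (S.hαpos (T + 1) (by omega))
      (S.hαanti (t + 1) (T + 1) (by omega) (by omega))
    exact mul_le_mul_of_nonneg_right (mul_le_mul_of_nonneg_right h S.hK.le)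
      (sum_nonneg fun i _ => norm_nonneg _)
  have hcons' := mul_le_mul_of_nonneg_left hcons S.hF.le
  rw [hA1, mul_inv] at hdual
  linarith

end Alg

section PowerSums

open Finset

lemma sum_inv_rpow_le (a : ℝ) (ha0 : 0 < a) (ha1 : a < 1) (T : ℕ) :
    ∑ t ∈ Icc 1 T, ((t : ℝ) ^ a)⁻¹ ≤ (T : ℝ) ^ (1 - a) / (1 - a) := by
  have h1a : 0 < 1 - a := by linarith
  induction T with
  | zero => simp [Real.zero_rpow h1a.ne']
  | succ T ih =>
    rw [sum_Icc_succ_top (by omega)]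
    refine (add_le_add_left ih _).trans ?_
    rw [← le_sub_iff_add_le', ← sub_div, le_div_iff₀ h1a]
    push_cast
    have hT : (0 : ℝ) < T + 1 := by positivity
    have hb := rpow_one_add_le_one_add_mul_self (s := -(1 / ((T : ℝ) + 1)))
      (by rw [neg_le_neg_iff, div_le_one hT]; linarith [Nat.cast_nonneg (α := ℝ) T]) h1a.le
      (by linarith)
    have h2 : (1 : ℝ) + -(1 / ((T : ℝ) + 1)) = T / (T + 1) := by field_simp; ring
    rw [h2, Real.div_rpow (Nat.cast_nonneg T) hT.le, div_le_iff₀ (by positivity)] at hb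
    have h3 : ((T : ℝ) + 1) ^ (1 - a) = (T + 1) * (((T : ℝ) + 1) ^ a)⁻¹ := by
      rw [Real.rpow_sub hT, Real.rpow_one, div_eq_mul_inv]
    have h4 : (1 + (1 - a) * -(1 / ((T : ℝ) + 1))) * ((T : ℝ) + 1) ^ (1 - a)
        = ((T : ℝ) + 1) ^ (1 - a) - (((T : ℝ) + 1) ^ a)⁻¹ * (1 - a) := by
      rw [h3]; field_simp; ring
    linarith

end PowerSums

theorem statement_9 {n m : ℕ} {p : Fin n → ℕ} (S : Alg n m p)
    (c κ : ℝ) (hc0 : 0 < c) (hc1 : c < 1) (hκ0 : 0 < κ) (hκ1 : κ < 1)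
    (hα : ∀ t : ℕ, 1 ≤ t → S.α t = ((t : ℝ) ^ c)⁻¹)
    (hβ : ∀ t : ℕ, 1 ≤ t → S.β t = ((t : ℝ) ^ κ)⁻¹)
    (hγ : ∀ t : ℕ, 1 ≤ t → S.γ t = ((t : ℝ) ^ (1 - κ))⁻¹)
    (T : ℕ) (hT : 1 ≤ T)
    (ys : ℕ → ∀ i, EuclideanSpace ℝ (Fin (p i)))
    (hysfeas : S.Feasible T ys)
    (hysmin : ∀ z, S.Feasible T z → S.VPhi T ys ≤ S.VPhi T z) :
    S.violation T ^ 2 ≤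
      (2 * (n : ℝ) * (2 * S.G ^ 2 / ((1 - c) * S.sigmin) + 1 / (1 - κ) + 2)) * (2 * (n : ℝ) * S.F + (S.C11 / κ + S.C12 / (1 - c) + 2 * (n : ℝ) * S.dX * S.K))
        * (T : ℝ) ^ max (2 - c) (2 - κ)
      + S.K * (2 * (n : ℝ) * (2 * S.G ^ 2 / ((1 - c) * S.sigmin) + 1 / (1 - κ) + 2)) * (T : ℝ) ^ max (1 : ℝ) (1 + c - κ) * S.VPhi T ys := by

  have hT1 : (1 : ℝ) ≤ T := by exact_mod_cast hT
  have hT0 : (0 : ℝ) < T := by linarith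
  have hcast : ∀ t : ℕ, 1 ≤ t → (0 : ℝ) < t := fun t ht => by exact_mod_cast ht
  have hn1 : (1 : ℝ) ≤ n := by exact_mod_cast S.hn
  have h1c : 0 < 1 - c := by linarith
  have h1κ : 0 < 1 - κ := by linarith
  have hσ := S.sigmin_pos
  have hF := S.hF
  have hB := S.B1_pos
  have hK := S.hK
  have hdX := S.hdX
  have hβγ : ∀ t, 1 ≤ t → S.β t * S.γ t = (t : ℝ)⁻¹ := by
    intro t ht
    rw [hβ t ht, hγ t ht, ← mul_inv, ← Real.rpow_add (hcast t ht)]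
    simp
  have hγβ : ∀ t, 1 ≤ t → S.β t * S.γ t ≤ 1 := by
    intro t ht
    rw [hβγ t ht]
    exact inv_le_one_of_one_le₀ (by exact_mod_cast ht)
  have hγstep : ∀ t, 1 ≤ t → (S.γ (t + 1))⁻¹ - S.β (t + 1) ≤ (S.γ t)⁻¹ := by
    intro t ht
    have hβa := S.hβanti t (t + 1) ht (by omega)
    have h1 : ∀ s, 1 ≤ s → (S.γ s)⁻¹ = s * S.β s := by
      intro s hs
      have h2 := S.hγpos s hs
      have h3 := hβγ s hs
      have h4 := hcast s hs
      rw [eq_comm, ← mul_eq_one_iff_eq_inv₀ h2.ne', mul_assoc, h3, mul_inv_cancel₀ h4.ne']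
    rw [h1 t ht, h1 (t + 1) (by omega)]
    push_cast
    nlinarith [hcast t ht]
  have hmain := S.inner_sum_gsum_le hγβ hγstep _
    (fun i u hu v hv => S.G_mul_norm_sub_le c hc1 i hu hv) T hT ys hysfeas
  obtain ⟨hl0, hl1, hρ0, hρ1, -⟩ := S.sum_consensus_error_le hγβ T
  set ρ := 1 - S.w / (2 * (n : ℝ) ^ 2) with hρ
  have hα1 : (S.α (T + 1))⁻¹ ≤ 1 + c * T := by
    rw [hα _ (by omega), inv_inv]
    push_cast
    rw [add_comm (T : ℝ) 1]
    exact rpow_one_add_le_one_add_mul_self (by linarith) hc0.le hc1.le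
  have hαT : (S.α T)⁻¹ = (T : ℝ) ^ c := by rw [hα T hT, inv_inv]
  have hγ1 : (S.γ 1)⁻¹ = 1 := by rw [hγ 1 le_rfl]; simp
  have hsα : ∑ t ∈ Finset.Icc 1 T, S.α t ≤ (T : ℝ) ^ (1 - c) / (1 - c) := by
    rw [Finset.sum_congr rfl fun t ht => hα t (Finset.mem_Icc.1 ht).1]
    exact sum_inv_rpow_le c hc0 hc1 T
  have hsβ : ∑ t ∈ Finset.Icc 1 T, S.β t ≤ (T : ℝ) ^ (1 - κ) / (1 - κ) := by
    rw [Finset.sum_congr rfl fun t ht => hβ t (Finset.mem_Icc.1 ht).1]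
    exact sum_inv_rpow_le κ hκ0 hκ1 T
  have hsγ : ∑ t ∈ Finset.Icc 1 T, S.γ t ≤ T / κ := by
    rw [Finset.sum_congr rfl fun t ht => hγ t (Finset.mem_Icc.1 ht).1]
    refine (sum_inv_rpow_le (1 - κ) h1κ (by linarith) T).trans ?_
    rw [sub_sub_cancel]
    gcongr
    simpa using Real.rpow_le_rpow_of_exponent_le hT1 hκ1.le
  have hV0 : 0 ≤ S.VPhi T ys :=
    Finset.sum_nonneg fun t _ => Finset.sum_nonneg fun i _ => norm_nonneg _
  -- the additive remainder grows at most linearly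
  set C1 := S.C11 / κ + S.C12 / (1 - c) + 2 * (n : ℝ) * S.dX * S.K with hC1
  set θ := max (1 - c) (1 - κ) with hθ
  have hcoef : n * S.B1 ^ 2 / 2 + S.F * (n * S.B1 / (ρ * (1 - S.lam))) ≤ S.C11 := by
    have h1 : S.tau = (ρ ^ 2)⁻¹ := rfl
    have h1l : 0 < 1 - S.lam := by linarith
    have h2 : S.F * (n * S.B1 / (ρ * (1 - S.lam)))
        ≤ 3 * (n : ℝ) ^ 2 * S.tau * S.B1 * S.F / (1 - S.lam) := by
      have h3 : ρ⁻¹ ≤ S.tau := by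
        rw [h1]
        exact inv_anti₀ (by positivity) (by nlinarith)
      have h4 : (n : ℝ) ≤ 3 * (n : ℝ) ^ 2 := by nlinarith
      calc S.F * (n * S.B1 / (ρ * (1 - S.lam)))
          = n * ρ⁻¹ * S.B1 * S.F / (1 - S.lam) := by field_simp
        _ ≤ _ := by gcongr
    rw [Alg.C11]
    linarith
  have hR : ∀ v : EuclideanSpace ℝ (Fin m), (∀ j, 0 ≤ v j) →
      ⟪v, ∑ t ∈ Finset.Icc 1 T, S.gsum t (S.x t)⟫
        ≤ n / 2 * (2 * S.G ^ 2 / ((1 - c) * S.sigmin) + 1 / (1 - κ) + 2) * (T : ℝ) ^ θ * ‖v‖ ^ 2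
          + ((2 * n * S.F + C1) * T + S.K * (T : ℝ) ^ c * S.VPhi T ys) := by
    intro v hv
    refine (hmain v hv).trans ?_
    rw [hαT, hγ1]
    have hθ0 : 1 ≤ (T : ℝ) ^ θ :=
      Real.one_le_rpow hT1 (h1c.le.trans (le_max_left _ _))
    have hθc : (T : ℝ) ^ (1 - c) ≤ (T : ℝ) ^ θ :=
      Real.rpow_le_rpow_of_exponent_le hT1 (le_max_left _ _)
    have hθκ : (T : ℝ) ^ (1 - κ) ≤ (T : ℝ) ^ θ :=
      Real.rpow_le_rpow_of_exponent_le hT1 (le_max_right _ _)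
    have hquad : ∑ t ∈ Finset.Icc 1 T, S.β t
        + S.G ^ 2 / S.sigmin * ∑ t ∈ Finset.Icc 1 T, S.α t + 1
        ≤ (2 * S.G ^ 2 / ((1 - c) * S.sigmin) + 1 / (1 - κ) + 2) * (T : ℝ) ^ θ := by
      have h1 : ∑ t ∈ Finset.Icc 1 T, S.β t ≤ 1 / (1 - κ) * (T : ℝ) ^ θ := by
        refine hsβ.trans ?_
        rw [div_mul_eq_mul_div, one_mul]
        gcongr
      have h2 : S.G ^ 2 / S.sigmin * ∑ t ∈ Finset.Icc 1 T, S.α t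
          ≤ S.G ^ 2 / ((1 - c) * S.sigmin) * (T : ℝ) ^ θ := by
        calc S.G ^ 2 / S.sigmin * ∑ t ∈ Finset.Icc 1 T, S.α t
            ≤ S.G ^ 2 / S.sigmin * ((T : ℝ) ^ θ / (1 - c)) := by
              gcongr
              exact hsα.trans (by gcongr)
          _ = _ := by field_simp
      have h3 : 0 ≤ S.G ^ 2 / ((1 - c) * S.sigmin) * (T : ℝ) ^ θ := by positivity
      have h4 : 2 * S.G ^ 2 / ((1 - c) * S.sigmin) = 2 * (S.G ^ 2 / ((1 - c) * S.sigmin)) := by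
        ring
      rw [h4]
      linarith
    have hq : n / 2 * (∑ t ∈ Finset.Icc 1 T, S.β t
        + S.G ^ 2 / S.sigmin * ∑ t ∈ Finset.Icc 1 T, S.α t + 1) * ‖v‖ ^ 2
        ≤ n / 2 * ((2 * S.G ^ 2 / ((1 - c) * S.sigmin) + 1 / (1 - κ) + 2) * (T : ℝ) ^ θ)
          * ‖v‖ ^ 2 := by gcongr
    have hg : (n * S.B1 ^ 2 / 2 + S.F * (n * S.B1 / (ρ * (1 - S.lam))))
        * ∑ t ∈ Finset.Icc 1 T, S.γ t ≤ S.C11 / κ * T := by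
      have h0 : 0 ≤ ∑ t ∈ Finset.Icc 1 T, S.γ t :=
        Finset.sum_nonneg fun t ht => (S.hγpos t (Finset.mem_Icc.1 ht).1).le
      have hl1' : 0 < 1 - S.lam := by linarith
      have h1 : 0 ≤ S.C11 := le_trans (by positivity) hcoef
      calc _ ≤ S.C11 * (T / κ) := mul_le_mul hcoef hsγ h0 h1
        _ = _ := by ring
    have hbreg : (S.α (T + 1))⁻¹ * (n * (S.K * S.dX)) ≤ (1 + c * T) * (n * (S.K * S.dX)) := by
      gcongr
    have hC12 : (n : ℝ) * (4 * S.G ^ 2 / (S.sigmin * (1 - c))) = S.C12 / (1 - c) := by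
      rw [Alg.C12]; field_simp
    have hslack : 0 ≤ (T - 1) * (n * (S.K * S.dX)) :=
      mul_nonneg (by linarith) (by positivity)
    have e1 : n * (2 * S.F + (4 * S.G ^ 2 / (S.sigmin * (1 - c)) + (1 - c) * (S.dX * S.K))) * T
        = (2 * n * S.F + S.C12 / (1 - c) + (1 - c) * n * (S.dX * S.K)) * T := by
      rw [← hC12]; ring
    rw [e1, hC1]
    clear_value θ ρ
    linarith
  set P := 2 * S.G ^ 2 / ((1 - c) * S.sigmin) + 1 / (1 - κ) + 2 with hP
  have hP0 : 0 < P := by positivity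
  set R := (2 * n * S.F + C1) * T + S.K * (T : ℝ) ^ c * S.VPhi T ys with hRdef
  have hTθ : 0 < (T : ℝ) ^ θ := Real.rpow_pos_of_pos hT0 _
  have hn0 : (0 : ℝ) < n := by linarith
  have hsq : S.violation T ^ 2 ≤ 2 * n * P * (T : ℝ) ^ θ * R := by
    rw [Alg.violation]
    set u := ∑ t ∈ Finset.Icc 1 T, S.gsum t (S.x t) with hu
    set b := n / 2 * P * (T : ℝ) ^ θ with hb
    have hb0 : 0 < b := by positivity
    have h := hR ((2 * b)⁻¹ • posPart u) (fun j => by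
      simpa using mul_nonneg (inv_pos.2 (show 0 < 2 * b by positivity)).le
        (le_max_right (u j) 0))
    rw [real_inner_smul_left, inner_posPart_self, norm_smul, mul_pow,
      Real.norm_of_nonneg (by positivity)] at h
    have h2 : (2 * b)⁻¹ * ‖posPart u‖ ^ 2 - b * ((2 * b)⁻¹ ^ 2 * ‖posPart u‖ ^ 2)
        = ‖posPart u‖ ^ 2 / (4 * b) := by field_simp; ring
    have h3 : ‖posPart u‖ ^ 2 / (4 * b) ≤ R := by linarith
    rw [div_le_iff₀ (by positivity)] at h3
    refine h3.trans_eq ?_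
    rw [hb]; ring
  have hp1 : (T : ℝ) ^ max (2 - c) (2 - κ) = (T : ℝ) ^ θ * T := by
    rw [show max (2 - c) (2 - κ) = θ + 1 by
      rw [hθ, ← max_add_add_right]; congr 1 <;> ring]
    rw [Real.rpow_add hT0, Real.rpow_one]
  have hp2 : (T : ℝ) ^ max (1 : ℝ) (1 + c - κ) = (T : ℝ) ^ θ * (T : ℝ) ^ c := by
    rw [← Real.rpow_add hT0, hθ, ← max_add_add_right]
    congr 2 <;> ring
  rw [hp1, hp2]
  refine hsq.trans_eq ?_
  rw [hRdef]
  ring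

end
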